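/- Let r ≥ 2 and let J = (i_1, …, i_l) be a sequence with each i_t ∈ {1, …, r−1}. Every Koszul homology module H_q of the Koszul complex K(R_J; x_1 − y_1, …, x_r − y_r) (these modules compute the Hochschild homology of the Soergel bimodule associated to J) is a free module over ℤ[x_1, …, x_r]. -/

import Mathlib

noncomputable section
open MvPolynomial

/-- The polynomial ring `ℤ[x_1,…,x_r,δ_1,…,δ_l]` with `r = m + 2` strands:
`Sum.inl` indexes the `x`'s and `Sum.inr` indexes the `δ`'s. -/
abbrev BSPoly (m l : ℕ) := MvPolynomial (Fin (m + 2) ⊕ Fin l) ℤ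

/-- The Bott–Samelson relation attached to `t`:
`δ_t·(δ_t + x_{i_t} − x_{i_t+1} + 2·Σ_{s<t, i_s=i_t} δ_s − Σ_{s<t, |i_s−i_t|=1} δ_s)`.
Crossing indices are zero-based: `i t : Fin (m+1)` encodes the simple reflection between
strands `i t` and `i t + 1` (zero-based), so `x_{i_t} = X (Sum.inl (i t).castSucc)` and
`x_{i_t+1} = X (Sum.inl (i t).succ)`. -/
def BSrel (m l : ℕ) (i : Fin l → Fin (m + 1)) (t : Fin l) : BSPoly m l :=
  X (Sum.inr t) *
    (X (Sum.inr t) + X (Sum.inl (i t).castSucc) - X (Sum.inl (i t).succ)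
      + 2 * ∑ s ∈ Finset.univ.filter fun s => s < t ∧ i s = i t, X (Sum.inr s)
      - ∑ s ∈ Finset.univ.filter
          fun s => s < t ∧ ((i s : ℕ) = (i t : ℕ) + 1 ∨ (i t : ℕ) = (i s : ℕ) + 1),
          X (Sum.inr s))

/-- The Bott–Samelson ring `R_J = ℤ[x,δ]/I_J`. -/
abbrev BSRing (m l : ℕ) (i : Fin l → Fin (m + 1)) :=
  BSPoly m l ⧸ Ideal.span (Set.range (BSrel m l i))

/-- `x_j ∈ R_J`. -/
def xB (m l : ℕ) (i : Fin l → Fin (m + 1)) (j : Fin (m + 2)) : BSRing m l i :=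
  Ideal.Quotient.mk _ (X (Sum.inl j))

/-- `δ_t ∈ R_J`. -/
def δB (m l : ℕ) (i : Fin l → Fin (m + 1)) (t : Fin l) : BSRing m l i :=
  Ideal.Quotient.mk _ (X (Sum.inr t))

/-- `δ̂_c = Σ_{t : i_t = c} δ_t ∈ R_J`, indexed by an integer `c` so that the conventions
`δ̂_0 = δ̂_r = 0` (one-based) hold automatically. -/
def δhat (m l : ℕ) (i : Fin l → Fin (m + 1)) (c : ℤ) : BSRing m l i :=
  ∑ t ∈ Finset.univ.filter fun t => ((i t : ℕ) : ℤ) = c, δB m l i t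

/-- `y_j = x_j + δ̂_j − δ̂_{j−1} ∈ R_J` (zero-based `j`). -/
def yB (m l : ℕ) (i : Fin l → Fin (m + 1)) (j : Fin (m + 2)) : BSRing m l i :=
  xB m l i j + δhat m l i (j : ℤ) - δhat m l i ((j : ℤ) - 1)

/-- The ring homomorphism `ℤ[x_1,…,x_r,y_1,…,y_r] → R_J`, `x_j ↦ x_j`, `y_j ↦ y_j`. -/
def toBS (m l : ℕ) (i : Fin l → Fin (m + 1)) :
    MvPolynomial (Fin (m + 2) ⊕ Fin (m + 2)) ℤ →+* BSRing m l i :=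
  (MvPolynomial.aeval fun v => Sum.elim (xB m l i) (yB m l i) v).toRingHom

/-- The ring homomorphism `ℤ[x_1,…,x_r] → R_J`, `x_j ↦ x_j`. -/
def ψBS (m l : ℕ) (i : Fin l → Fin (m + 1)) :
    MvPolynomial (Fin (m + 2)) ℤ →+* BSRing m l i :=
  (MvPolynomial.aeval fun j => xB m l i j).toRingHom


/-- The underlying module of the Koszul complex `B ⊗ Λ(x̂_1,…,x̂_r)`: a free `B`-module
with basis the square-free monomials `x̂_S = x̂_{s_1}∧⋯∧x̂_{s_q}` (`s_1 < ⋯ < s_q`)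
indexed by finsets `S ⊆ Fin r`. -/
abbrev KModule (B : Type*) [CommRing B] (r : ℕ) := Finset (Fin r) → B

/-- The Koszul sign `(−1)^{#{j ∈ t | j < i}}` arising when moving `x̂_i` past the
generators of `x̂_t` that precede it. -/
def ksign {B : Type*} [CommRing B] {r : ℕ} (i : Fin r) (t : Finset (Fin r)) : B :=
  (-1) ^ (t.filter fun j => j < i).card

/-- The Koszul differential of `K(B; z_1,…,z_r)`: the `B`-linear map of exterior
degree `−1` determined by the graded Leibniz rule and `d(x̂_i) = z i`; on basis
elements, `d(x̂_S) = Σ_{i ∈ S} ±(z i)·x̂_{S∖i}`. -/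
def koszulD {B : Type*} [CommRing B] {r : ℕ} (z : Fin r → B) :
    KModule B r →ₗ[B] KModule B r where
  toFun f t := ∑ i ∈ tᶜ, ksign i t * z i * f (insert i t)
  map_add' f g := by
    funext t
    simp [Pi.add_apply, mul_add, Finset.sum_add_distrib]
  map_smul' c f := by
    funext t
    simp only [Pi.smul_apply, smul_eq_mul, RingHom.id_apply, Finset.mul_sum]
    exact Finset.sum_congr rfl fun i _ => by ring

/-- Left exterior multiplication by the degree-1 element `Σ_i (c i)·x̂_i`: the
`B`-linear map of exterior degree `+1` with `x̂_S ↦ Σ_{i ∉ S} ±(c i)·x̂_{S∪i}`. -/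
def extMul {B : Type*} [CommRing B] {r : ℕ} (c : Fin r → B) :
    KModule B r →ₗ[B] KModule B r where
  toFun f t := ∑ i ∈ t, ksign i (t.erase i) * c i * f (t.erase i)
  map_add' f g := by
    funext t
    simp [Pi.add_apply, mul_add, Finset.sum_add_distrib]
  map_smul' a f := by
    funext t
    simp only [Pi.smul_apply, smul_eq_mul, RingHom.id_apply, Finset.mul_sum]
    exact Finset.sum_congr rfl fun i _ => by ring

/-- The exterior-degree-`q` summand of the Koszul complex (indexed by `q : ℤ`, so
negative degrees vanish automatically). -/
def kdeg (B : Type*) [CommRing B] (r : ℕ) (q : ℤ) : Submodule B (KModule B r) where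
  carrier := {f | ∀ s : Finset (Fin r), (s.card : ℤ) ≠ q → f s = 0}
  add_mem' := by
    intro f g hf hg s hs
    simp [Pi.add_apply, hf s hs, hg s hs]
  zero_mem' := by intro s _; rfl
  smul_mem' := by
    intro c f hf s hs
    simp [Pi.smul_apply, hf s hs]

/-- Degree-`q` cycles of the Koszul complex `K(B; z)`. -/
def kcycles {B : Type*} [CommRing B] {r : ℕ} (z : Fin r → B) (q : ℤ) :
    Submodule B (KModule B r) :=
  kdeg B r q ⊓ LinearMap.ker (koszulD z)

/-- Degree-`q` boundaries of the Koszul complex `K(B; z)`. -/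
def kbdries {B : Type*} [CommRing B] {r : ℕ} (z : Fin r → B) (q : ℤ) :
    Submodule B (KModule B r) :=
  Submodule.map (koszulD z) (kdeg B r (q + 1))

/-- The degree-`q` Koszul homology `H_q` of `K(B; z)`. -/
abbrev KH {B : Type*} [CommRing B] {r : ℕ} (z : Fin r → B) (q : ℤ) :=
  kcycles z q ⧸ (kbdries z q).comap (kcycles z q).subtype

section Demazure

variable {k : Type} [CommRing k]

/-- The additive generators of the action: a homomorphism of abelian groups commuting with scalars
and variables is linear over the polynomial ring. -/
def MvPolynomial.linearMapOfAdd {M N : Type} [AddCommGroup M] [Module (MvPolynomial ℕ k) M]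
    [AddCommGroup N] [Module (MvPolynomial ℕ k) N] (f : M →+ N)
    (hC : ∀ (a : k) v, f ((C a : MvPolynomial ℕ k) • v) = (C a : MvPolynomial ℕ k) • f v)
    (hX : ∀ (n : ℕ) v, f ((X n : MvPolynomial ℕ k) • v) = (X n : MvPolynomial ℕ k) • f v) :
    M →ₗ[MvPolynomial ℕ k] N where
  toFun := f
  map_add' := f.map_add
  map_smul' p v := by
    simp only [RingHom.id_apply]
    induction p using MvPolynomial.induction_on generalizing v with
    | C a => exact hC a v
    | add p q hp hq => rw [add_smul, map_add, hp, hq, add_smul]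
    | mul_X p n hp => rw [mul_smul, hp, hX, mul_smul]

/-- The ring homomorphism `X n ↦ X n + ε n • δ` into endomorphisms of a module. -/
def twistAction {N : Type} [AddCommGroup N] [Module (MvPolynomial ℕ k) N]
    (δ : Module.End (MvPolynomial ℕ k) N) (ε : ℕ → ℤ) :
    MvPolynomial ℕ k →+* Module.End (MvPolynomial ℕ k) N :=
  (Polynomial.aeval δ : Polynomial (MvPolynomial ℕ k) →ₐ[MvPolynomial ℕ k] _).toRingHom.comp
    (eval₂Hom (Polynomial.C.comp C) fun n =>
      Polynomial.C (X n) + Polynomial.C ((ε n : ℤ) : MvPolynomial ℕ k) * Polynomial.X)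

theorem twistAction_C {N : Type} [AddCommGroup N] [Module (MvPolynomial ℕ k) N]
    (δ : Module.End (MvPolynomial ℕ k) N) (ε : ℕ → ℤ) (a : k) (v : N) :
    twistAction δ ε (C a) v = (C a : MvPolynomial ℕ k) • v := by
  simp [twistAction]

theorem twistAction_X {N : Type} [AddCommGroup N] [Module (MvPolynomial ℕ k) N]
    (δ : Module.End (MvPolynomial ℕ k) N) (ε : ℕ → ℤ) (n : ℕ) (v : N) :
    twistAction δ ε (X n) v = (X n : MvPolynomial ℕ k) • v + ε n • δ v := by
  simp [twistAction]

/-- The signs with which `δ` enters the action of the variables across a crossing `i`. -/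
def crossingSign (i n : ℕ) : ℤ := if n = i then 1 else if n = i + 1 then -1 else 0

/-- The module `M ⊗ B_i`, realised on `M ⊕ M δ` with `δ² = (X (i+1) - X i) δ`, where `X i` acts as
`X i + δ` and `X (i+1)` acts as `X (i+1) - δ`. -/
def Crossing (_i : ℕ) (M : Type) : Type := M × M

namespace Crossing

variable (i : ℕ) {M N : Type} [AddCommGroup M] [Module (MvPolynomial ℕ k) M]
  [AddCommGroup N] [Module (MvPolynomial ℕ k) N]

instance : AddCommGroup (Crossing i M) := inferInstanceAs (AddCommGroup (M × M))

/-- Multiplication by `δ` on `M ⊕ M δ`. -/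
def delta (k : Type) [CommRing k] (i : ℕ) (M : Type) [AddCommGroup M]
    [Module (MvPolynomial ℕ k) M] : Module.End (MvPolynomial ℕ k) (M × M) :=
  LinearMap.prod 0 (LinearMap.fst _ M M +
    (X (i + 1) - X i : MvPolynomial ℕ k) • LinearMap.snd _ M M)

instance : Module (MvPolynomial ℕ k) (Crossing i M) :=
  Module.compHom (M × M) (twistAction (delta k i M) (crossingSign i))

variable {i}

/-- The coefficient of `1`. -/
def fst : Crossing i M →+ M := AddMonoidHom.fst M M

/-- The coefficient of `δ`. -/
def snd : Crossing i M →+ M := AddMonoidHom.snd M M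

/-- The element `a + b δ`. -/
def mk (a b : M) : Crossing i M := (a, b)

@[simp] theorem fst_mk (a b : M) : fst (mk a b : Crossing i M) = a := rfl
@[simp] theorem snd_mk (a b : M) : snd (mk a b : Crossing i M) = b := rfl

@[ext] theorem ext {v w : Crossing i M} (h₁ : fst v = fst w) (h₂ : snd v = snd w) : v = w :=
  Prod.ext h₁ h₂

@[simp] theorem fst_C (a : k) (v : Crossing i M) :
    fst ((C a : MvPolynomial ℕ k) • v) = (C a : MvPolynomial ℕ k) • fst v :=
  congrArg Prod.fst (twistAction_C (delta k i M) (crossingSign i) a v)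

@[simp] theorem snd_C (a : k) (v : Crossing i M) :
    snd ((C a : MvPolynomial ℕ k) • v) = (C a : MvPolynomial ℕ k) • snd v :=
  congrArg Prod.snd (twistAction_C (delta k i M) (crossingSign i) a v)

@[simp] theorem fst_X (n : ℕ) (v : Crossing i M) :
    fst ((X n : MvPolynomial ℕ k) • v) = (X n : MvPolynomial ℕ k) • fst v :=
  (congrArg Prod.fst (twistAction_X (delta k i M) (crossingSign i) n v)).trans
    (show (X n : MvPolynomial ℕ k) • fst v + crossingSign i n • (0 : M) = _ by simp)

theorem snd_X (n : ℕ) (v : Crossing i M) :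
    snd ((X n : MvPolynomial ℕ k) • v) = (X n : MvPolynomial ℕ k) • snd v +
      crossingSign i n • (fst v + (X (i + 1) - X i : MvPolynomial ℕ k) • snd v) :=
  congrArg Prod.snd (twistAction_X (delta k i M) (crossingSign i) n v)

theorem snd_X_self (v : Crossing i M) :
    snd ((X i : MvPolynomial ℕ k) • v) = fst v + (X (i + 1) : MvPolynomial ℕ k) • snd v := by
  rw [snd_X, crossingSign, if_pos rfl]; module

theorem snd_X_succ (v : Crossing i M) :
    snd ((X (i + 1) : MvPolynomial ℕ k) • v) =
      (X i : MvPolynomial ℕ k) • snd v - fst v := by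
  rw [snd_X, crossingSign, if_neg (by omega), if_pos rfl]; module

theorem snd_X_of_ne {n : ℕ} (h : n ≠ i) (h' : n ≠ i + 1) (v : Crossing i M) :
    snd ((X n : MvPolynomial ℕ k) • v) = (X n : MvPolynomial ℕ k) • snd v := by
  rw [snd_X, crossingSign, if_neg h, if_neg h']; module

/-- Functoriality of `M ↦ M ⊗ B_i`. -/
def map (i : ℕ) (f : M →ₗ[MvPolynomial ℕ k] N) :
    Crossing i M →ₗ[MvPolynomial ℕ k] Crossing i N :=
  linearMapOfAdd (AddMonoidHom.prodMap f.toAddMonoidHom f.toAddMonoidHom)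
    (fun a v => ext
      (show f (fst (_ • v)) = fst (C a • (mk (f (fst v)) (f (snd v)) : Crossing i N)) by simp)
      (show f (snd (_ • v)) = snd (C a • (mk (f (fst v)) (f (snd v)) : Crossing i N)) by simp))
    (fun n v => ext
      (show f (fst (_ • v)) = fst (X n • (mk (f (fst v)) (f (snd v)) : Crossing i N)) by simp)
      (show f (snd (_ • v)) = snd (X n • (mk (f (fst v)) (f (snd v)) : Crossing i N)) by
        simp [snd_X]))

@[simp] theorem fst_map (f : M →ₗ[MvPolynomial ℕ k] N) (v : Crossing i M) :
    fst (map i f v) = f (fst v) := rfl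
@[simp] theorem snd_map (f : M →ₗ[MvPolynomial ℕ k] N) (v : Crossing i M) :
    snd (map i f v) = f (snd v) := rfl

end Crossing

end Demazure

section Decompositions

variable {k : Type} [CommRing k]

/-- `M` is a direct summand of `N₁ ⊕ N₂`. -/
def IsSummandOf (R : Type) [CommRing R] (M N₁ N₂ : Type) [AddCommGroup M] [Module R M]
    [AddCommGroup N₁] [Module R N₁] [AddCommGroup N₂] [Module R N₂] : Prop :=
  ∃ (f₁ : M →ₗ[R] N₁) (g₁ : N₁ →ₗ[R] M) (f₂ : M →ₗ[R] N₂) (g₂ : N₂ →ₗ[R] M),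
    ∀ v, g₁ (f₁ v) + g₂ (f₂ v) = v

variable {M N₁ N₂ : Type} [AddCommGroup M] [Module (MvPolynomial ℕ k) M]
  [AddCommGroup N₁] [Module (MvPolynomial ℕ k) N₁]
  [AddCommGroup N₂] [Module (MvPolynomial ℕ k) N₂]

open Crossing

theorem IsSummandOf.crossing (i : ℕ) (h : IsSummandOf (MvPolynomial ℕ k) M N₁ N₂) :
    IsSummandOf (MvPolynomial ℕ k) (Crossing i M) (Crossing i N₁) (Crossing i N₂) := by
  obtain ⟨f₁, g₁, f₂, g₂, h⟩ := h
  exact ⟨map i f₁, map i g₁, map i f₂, map i g₂, fun v => by ext <;> simp [h]⟩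

/-- A map is linear over the polynomial ring when it is additive and commutes with constants and
variables. -/
theorem exists_linearMap (f : M → N₁) (hadd : ∀ v w, f (v + w) = f v + f w)
    (hC : ∀ (a : k) v, f ((C a : MvPolynomial ℕ k) • v) = (C a : MvPolynomial ℕ k) • f v)
    (hX : ∀ (n : ℕ) v, f ((X n : MvPolynomial ℕ k) • v) = (X n : MvPolynomial ℕ k) • f v) :
    ∃ F : M →ₗ[MvPolynomial ℕ k] N₁, ∀ v, F v = f v :=
  ⟨linearMapOfAdd (AddMonoidHom.mk' f hadd) hC hX, fun _ => rfl⟩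

theorem snd_X_of_add_one_eq {i n : ℕ} (h : i + 1 = n) (v : Crossing i M) :
    snd ((X i : MvPolynomial ℕ k) • v) = fst v + (X n : MvPolynomial ℕ k) • snd v := by
  subst h; exact snd_X_self v

theorem snd_X_of_eq_add_one {i n : ℕ} (h : i + 1 = n) (v : Crossing i M) :
    snd ((X n : MvPolynomial ℕ k) • v) = (X i : MvPolynomial ℕ k) • snd v - fst v := by
  subst h; exact snd_X_succ v

theorem isSummandOf_crossing_crossing (k : Type) [CommRing k] (M : Type) [AddCommGroup M]
    [Module (MvPolynomial ℕ k) M] (i : ℕ) :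
    IsSummandOf (MvPolynomial ℕ k) (Crossing i (Crossing i M)) (Crossing i M) (Crossing i M) := by
  obtain ⟨b, hb⟩ : ∃ b, i + 1 = b := ⟨_, rfl⟩
  have cases : ∀ {P : ℕ → Prop}, P i → P b → (∀ n, n ≠ i → n ≠ i + 1 → P n) → ∀ n, P n := by
    intro P h h' hn n
    by_cases h1 : n = i
    · exact h1 ▸ h
    by_cases h2 : n = b
    · exact h2 ▸ h'
    exact hn n h1 (hb ▸ h2)
  obtain ⟨f₁, hf₁⟩ := exists_linearMap (k := k) (M := Crossing i (Crossing i M))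
    (N₁ := Crossing i M) (fun v => mk (fst (fst v)) (fst (snd v)))
    (fun v w => by ext <;> simp) (fun a v => by ext <;> simp)
    (cases (fun v => by ext <;> simp [snd_X_of_add_one_eq hb, snd_X_of_eq_add_one hb])
      (fun v => by ext <;> simp [snd_X_of_add_one_eq hb, snd_X_of_eq_add_one hb])
      (fun n h h' v => by ext <;> simp [snd_X_of_ne h h']))
  obtain ⟨g₁, hg₁⟩ := exists_linearMap (k := k) (M := Crossing i M)
    (N₁ := Crossing i (Crossing i M)) (fun w => mk (mk (fst w) (snd w)) (mk (snd w) 0))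
    (fun v w => by ext <;> simp) (fun a v => by ext <;> simp)
    (cases (fun v => by ext <;> simp [snd_X_of_add_one_eq hb, snd_X_of_eq_add_one hb])
      (fun v => by ext <;> simp [snd_X_of_add_one_eq hb, snd_X_of_eq_add_one hb])
      (fun n h h' v => by ext <;> simp [snd_X_of_ne h h']))
  obtain ⟨f₂, hf₂⟩ := exists_linearMap (k := k) (M := Crossing i (Crossing i M))
    (N₁ := Crossing i M) (fun v => mk
      (snd (fst v) - fst (snd v) - (X b - X i : MvPolynomial ℕ k) • snd (snd v))
      (snd (snd v)))
    (fun v w => by ext <;> simp <;> module) (fun a v => by ext <;> simp <;> module)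
    (cases (fun v => by ext <;> simp [snd_X_of_add_one_eq hb, snd_X_of_eq_add_one hb] <;> module)
      (fun v => by ext <;> simp [snd_X_of_add_one_eq hb, snd_X_of_eq_add_one hb] <;> module)
      (fun n h h' v => by ext <;> simp [snd_X_of_ne h h'] <;> module))
  obtain ⟨g₂, hg₂⟩ := exists_linearMap (k := k) (M := Crossing i M)
    (N₁ := Crossing i (Crossing i M))
    (fun w => mk (mk 0 (fst w + (X b - X i : MvPolynomial ℕ k) • snd w)) (mk 0 (snd w)))
    (fun v w => by ext <;> simp <;> module) (fun a v => by ext <;> simp <;> module)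
    (cases (fun v => by ext <;> simp [snd_X_of_add_one_eq hb, snd_X_of_eq_add_one hb] <;> module)
      (fun v => by ext <;> simp [snd_X_of_add_one_eq hb, snd_X_of_eq_add_one hb] <;> module)
      (fun n h h' v => by ext <;> simp [snd_X_of_ne h h'] <;> module))
  exact ⟨f₁, g₁, f₂, g₂, fun v => by ext <;> simp [hf₁, hg₁, hf₂, hg₂]⟩

theorem isSummandOf_crossing_comm (k : Type) [CommRing k] (M : Type) [AddCommGroup M]
    [Module (MvPolynomial ℕ k) M] {i j : ℕ} (hij : i + 1 < j ∨ j + 1 < i) :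
    IsSummandOf (MvPolynomial ℕ k) (Crossing i (Crossing j M))
      (Crossing j (Crossing i M)) (Crossing j (Crossing i M)) := by
  have key : ∀ (i j : ℕ), (i + 1 < j ∨ j + 1 < i) →
      ∃ f : Crossing i (Crossing j M) →ₗ[MvPolynomial ℕ k] Crossing j (Crossing i M),
      ∀ v, f v = mk (mk (fst (fst v)) (fst (snd v))) (mk (snd (fst v)) (snd (snd v))) := by
    intro i j hij
    refine exists_linearMap _ (fun v w => by ext <;> simp) (fun a v => by ext <;> simp)
      fun n v => ?_
    by_cases hi : n ≠ i ∧ n ≠ i + 1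
    · have h₁ : crossingSign i n = 0 := by unfold crossingSign; split_ifs <;> omega
      have h₂ : crossingSign i j = 0 := by unfold crossingSign; split_ifs <;> omega
      have h₃ : crossingSign i (j + 1) = 0 := by unfold crossingSign; split_ifs <;> omega
      ext <;> simp [snd_X, sub_smul, h₁, h₂, h₃]
    · have h₁ : crossingSign j n = 0 := by unfold crossingSign; split_ifs <;> omega
      have h₂ : crossingSign j i = 0 := by unfold crossingSign; split_ifs <;> omega
      have h₃ : crossingSign j (i + 1) = 0 := by unfold crossingSign; split_ifs <;> omega
      ext <;> simp [snd_X, sub_smul, h₁, h₂, h₃]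
  obtain ⟨f, hf⟩ := key i j hij
  obtain ⟨g, hg⟩ := key j i hij.symm
  exact ⟨f, g, 0, 0, fun v => by ext <;> simp [hf, hg]⟩

set_option maxHeartbeats 2000000 in
theorem isSummandOf_braid (k : Type) [CommRing k] (M : Type) [AddCommGroup M]
    [Module (MvPolynomial ℕ k) M] {j b : ℕ} (hb : j + 1 = b) :
    IsSummandOf (MvPolynomial ℕ k) (Crossing b (Crossing j (Crossing b M)))
      (Crossing j (Crossing b (Crossing j M))) (Crossing b M) := by
  obtain ⟨c, hc⟩ : ∃ c, b + 1 = c := ⟨_, rfl⟩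
  have cases : ∀ {P : ℕ → Prop}, P j → P b → P c →
      (∀ n, n ≠ j → n ≠ j + 1 → n ≠ b → n ≠ b + 1 → P n) → ∀ n, P n := by
    intro P h h' h'' hn n
    by_cases h1 : n = j
    · exact h1 ▸ h
    by_cases h2 : n = b
    · exact h2 ▸ h'
    by_cases h3 : n = c
    · exact h3 ▸ h''
    exact hn n h1 (hb ▸ h2) h2 (hc ▸ h3)
  have n1 : j ≠ b := by omega
  have n2 : j ≠ b + 1 := by omega
  have n3 : c ≠ j := by omega
  have n4 : c ≠ j + 1 := by omega
  obtain ⟨f₁, hf₁⟩ := exists_linearMap (k := k) (M := Crossing b (Crossing j (Crossing b M)))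
    (N₁ := Crossing j (Crossing b (Crossing j M))) (fun v => mk
      (mk (mk (fst (fst (fst v)) + (X j - X b : MvPolynomial ℕ k) • snd (fst (fst v)) -
              (X j - X b : MvPolynomial ℕ k) • fst (fst (snd v)) +
              ((X j - X b) * (X b - X c) : MvPolynomial ℕ k) • snd (fst (snd v)))
            (snd (fst (fst v)) + fst (snd (fst v)) - fst (fst (snd v)) +
              (X b - X c : MvPolynomial ℕ k) • snd (fst (snd v))))
          (mk (fst (fst (snd v)) + (X j - X b : MvPolynomial ℕ k) • snd (fst (snd v)))
            (snd (fst (snd v)) + fst (snd (snd v)))))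
      (mk (mk (snd (fst (fst v)) + fst (snd (fst v)) - fst (fst (snd v)) +
          (X b - X c : MvPolynomial ℕ k) • snd (fst (snd v))) 0)
          (mk (snd (snd (fst v)) + snd (fst (snd v))) (snd (snd (snd v))))))
    (fun v w => by ext <;> simp <;> module) (fun a v => by ext <;> simp <;> module)
    (cases (fun v => by ext <;> simp [snd_X_of_add_one_eq hb, snd_X_of_eq_add_one hb,
          snd_X_of_add_one_eq hc, snd_X_of_eq_add_one hc, snd_X_of_ne n1 n2, snd_X_of_ne n3 n4] <;>
          module)
      (fun v => by ext <;> simp [snd_X_of_add_one_eq hb, snd_X_of_eq_add_one hb,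
          snd_X_of_add_one_eq hc, snd_X_of_eq_add_one hc, snd_X_of_ne n1 n2, snd_X_of_ne n3 n4] <;>
          module)
      (fun v => by ext <;> simp [snd_X_of_add_one_eq hb, snd_X_of_eq_add_one hb,
          snd_X_of_add_one_eq hc, snd_X_of_eq_add_one hc, snd_X_of_ne n1 n2, snd_X_of_ne n3 n4] <;>
          module)
      (fun n h1 h2 h3 h4 v => by
        ext <;> simp [snd_X_of_ne h1 h2, snd_X_of_ne h3 h4] <;> module))
  obtain ⟨g₁, hg₁⟩ := exists_linearMap (k := k) (M := Crossing j (Crossing b (Crossing j M)))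
    (N₁ := Crossing b (Crossing j (Crossing b M))) (fun v => mk
      (mk (mk (fst (fst (fst v)) + (X b - X c : MvPolynomial ℕ k) • snd (fst (fst v)) -
              (X b - X c : MvPolynomial ℕ k) • fst (fst (snd v)) +
              ((X j - X b) * (X b - X c) : MvPolynomial ℕ k) • snd (fst (snd v)))
            (snd (fst (fst v)) + fst (snd (fst v)) - fst (fst (snd v)) +
              (X j - X b : MvPolynomial ℕ k) • snd (fst (snd v))))
          (mk (fst (fst (snd v)) + (X b - X c : MvPolynomial ℕ k) • snd (fst (snd v)))
            (snd (fst (snd v)) + fst (snd (snd v)))))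
      (mk (mk (snd (fst (fst v)) + fst (snd (fst v)) - fst (fst (snd v)) +
          (X j - X b : MvPolynomial ℕ k) • snd (fst (snd v))) 0)
          (mk (snd (snd (fst v)) + snd (fst (snd v))) (snd (snd (snd v))))))
    (fun v w => by ext <;> simp <;> module) (fun a v => by ext <;> simp <;> module)
    (cases (fun v => by ext <;> simp [snd_X_of_add_one_eq hb, snd_X_of_eq_add_one hb,
          snd_X_of_add_one_eq hc, snd_X_of_eq_add_one hc, snd_X_of_ne n1 n2, snd_X_of_ne n3 n4] <;>
          module)
      (fun v => by ext <;> simp [snd_X_of_add_one_eq hb, snd_X_of_eq_add_one hb,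
          snd_X_of_add_one_eq hc, snd_X_of_eq_add_one hc, snd_X_of_ne n1 n2, snd_X_of_ne n3 n4] <;>
          module)
      (fun v => by ext <;> simp [snd_X_of_add_one_eq hb, snd_X_of_eq_add_one hb,
          snd_X_of_add_one_eq hc, snd_X_of_eq_add_one hc, snd_X_of_ne n1 n2, snd_X_of_ne n3 n4] <;>
          module)
      (fun n h1 h2 h3 h4 v => by
        ext <;> simp [snd_X_of_ne h1 h2, snd_X_of_ne h3 h4] <;> module))
  obtain ⟨f₂, hf₂⟩ := exists_linearMap (k := k) (M := Crossing b (Crossing j (Crossing b M)))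
    (N₁ := Crossing b M) (fun v => mk
      (fst (fst (snd v)) - snd (fst (fst v)) - (X b - X c : MvPolynomial ℕ k) • snd (fst (snd v)))
      (-snd (fst (snd v))))
    (fun v w => by ext <;> simp <;> module) (fun a v => by ext <;> simp <;> module)
    (cases (fun v => by ext <;> simp [snd_X_of_add_one_eq hb, snd_X_of_eq_add_one hb,
          snd_X_of_add_one_eq hc, snd_X_of_eq_add_one hc, snd_X_of_ne n1 n2, snd_X_of_ne n3 n4] <;>
          module)
      (fun v => by ext <;> simp [snd_X_of_add_one_eq hb, snd_X_of_eq_add_one hb,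
          snd_X_of_add_one_eq hc, snd_X_of_eq_add_one hc, snd_X_of_ne n1 n2, snd_X_of_ne n3 n4] <;>
          module)
      (fun v => by ext <;> simp [snd_X_of_add_one_eq hb, snd_X_of_eq_add_one hb,
          snd_X_of_add_one_eq hc, snd_X_of_eq_add_one hc, snd_X_of_ne n1 n2, snd_X_of_ne n3 n4] <;>
          module)
      (fun n h1 h2 h3 h4 v => by
        ext <;> simp [snd_X_of_ne h1 h2, snd_X_of_ne h3 h4] <;> module))
  obtain ⟨g₂, hg₂⟩ := exists_linearMap (k := k) (M := Crossing b M)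
    (N₁ := Crossing b (Crossing j (Crossing b M))) (fun w => mk
      (mk (mk ((X j - X b : MvPolynomial ℕ k) • fst w)
        (-fst w + (X j - X c : MvPolynomial ℕ k) • snd w)) (mk (fst w) (snd w)))
      (mk (mk ((X j - X b : MvPolynomial ℕ k) • snd w) (-snd w)) (mk (snd w) 0)))
    (fun v w => by ext <;> simp <;> module) (fun a v => by ext <;> simp <;> module)
    (cases (fun v => by ext <;> simp [snd_X_of_add_one_eq hb, snd_X_of_eq_add_one hb,
          snd_X_of_add_one_eq hc, snd_X_of_eq_add_one hc, snd_X_of_ne n1 n2, snd_X_of_ne n3 n4] <;>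
          module)
      (fun v => by ext <;> simp [snd_X_of_add_one_eq hb, snd_X_of_eq_add_one hb,
          snd_X_of_add_one_eq hc, snd_X_of_eq_add_one hc, snd_X_of_ne n1 n2, snd_X_of_ne n3 n4] <;>
          module)
      (fun v => by ext <;> simp [snd_X_of_add_one_eq hb, snd_X_of_eq_add_one hb,
          snd_X_of_add_one_eq hc, snd_X_of_eq_add_one hc, snd_X_of_ne n1 n2, snd_X_of_ne n3 n4] <;>
          module)
      (fun n h1 h2 h3 h4 v => by
        ext <;> simp [snd_X_of_ne h1 h2, snd_X_of_ne h3 h4] <;> module))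
  exact ⟨f₁, g₁, f₂, g₂, fun v => by ext <;> simp [hf₁, hg₁, hf₂, hg₂] <;> module⟩

end Decompositions

section RelativeProjectivity

/-- `M`, viewed as a `k`-module by restriction of scalars along `φ`, is projective. -/
def ProjectiveOver {k R : Type} [CommRing k] [CommRing R] (φ : k →+* R) (M : Type)
    [AddCommGroup M] [Module R M] : Prop :=
  @Module.Projective k _ M _ (Module.compHom M φ)

namespace ProjectiveOver

variable {k R M N P : Type} [CommRing k] [CommRing R] {φ : k →+* R} [AddCommGroup M]
  [Module R M] [AddCommGroup N] [Module R N] [AddCommGroup P] [Module R P]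

theorem of_retract (h : ProjectiveOver φ N) (f : M →ₗ[R] N) (g : N →ₗ[R] M)
    (hgf : ∀ v, g (f v) = v) : ProjectiveOver φ M := by
  let _ : Module k M := Module.compHom M φ
  let _ : Module k N := Module.compHom N φ
  let f' : M →ₗ[k] N := { f with map_smul' := fun c v => f.map_smul (φ c) v }
  let g' : N →ₗ[k] M := { g with map_smul' := fun c v => g.map_smul (φ c) v }
  have : Module.Projective k N := h
  exact Module.Projective.of_split f' g' (LinearMap.ext hgf)

theorem prod (hM : ProjectiveOver φ M) (hN : ProjectiveOver φ N) :
    ProjectiveOver φ (M × N) := by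
  let _ : Module k M := Module.compHom M φ
  let _ : Module k N := Module.compHom N φ
  have : Module.Projective k M := hM
  have : Module.Projective k N := hN
  exact inferInstanceAs (Module.Projective k (M × N))

theorem of_exact (hM : ProjectiveOver φ M) (hP : ProjectiveOver φ P) (f : M →ₗ[R] N)
    (g : N →ₗ[R] P) (hf : Function.Injective f) (hfg : Function.Exact f g)
    (hg : Function.Surjective g) : ProjectiveOver φ N := by
  let _ : Module k M := Module.compHom M φ
  let _ : Module k N := Module.compHom N φ
  let _ : Module k P := Module.compHom P φ
  let f' : M →ₗ[k] N := { f with map_smul' := fun c v => f.map_smul (φ c) v }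
  let g' : N →ₗ[k] P := { g with map_smul' := fun c v => g.map_smul (φ c) v }
  have : Module.Projective k M := hM
  have : Module.Projective k P := hP
  obtain ⟨s, hs⟩ := Module.projective_lifting_property g' LinearMap.id hg
  have hfg' : Function.Exact f' g' := hfg
  exact Module.Projective.of_equiv (hfg'.splitSurjectiveEquiv hf ⟨s, hs⟩).1.symm

end ProjectiveOver

end RelativeProjectivity

section Homology

variable {R M N : Type} [CommRing R] [AddCommGroup M] [Module R M] [AddCommGroup N] [Module R N]

/-- The total homology of a module with a differential. -/
abbrev Homology (d : Module.End R M) : Type :=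
  LinearMap.ker d ⧸ (LinearMap.range d).submoduleOf (LinearMap.ker d)

namespace Homology

/-- The class of a cycle. -/
def cls (d : Module.End R M) (v : M) (hv : d v = 0) : Homology d :=
  Submodule.Quotient.mk ⟨v, hv⟩

theorem exists_cls {d : Module.End R M} (x : Homology d) : ∃ v hv, cls d v hv = x := by
  obtain ⟨⟨v, hv⟩, rfl⟩ := Submodule.Quotient.mk_surjective _ x
  exact ⟨v, hv, rfl⟩

theorem cls_eq_zero {d : Module.End R M} {v : M} {hv : d v = 0} :
    cls d v hv = 0 ↔ ∃ w, d w = v :=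
  Submodule.Quotient.mk_eq_zero _

theorem cls_eq_cls {d : Module.End R M} {v w : M} {hv : d v = 0} {hw : d w = 0} :
    cls d v hv = cls d w hw ↔ ∃ u, d u = v - w :=
  Submodule.Quotient.eq _

/-- A linear map sending cycles to cycles and boundaries to boundaries induces a map on homology. -/
def lift {d : Module.End R M} {e : Module.End R N} (f : M →ₗ[R] N)
    (h₁ : ∀ v, d v = 0 → e (f v) = 0) (h₂ : ∀ v, ∃ w, e w = f (d v)) :
    Homology d →ₗ[R] Homology e :=
  Submodule.mapQ _ _ (f.restrict (p := LinearMap.ker d) (q := LinearMap.ker e) h₁) (by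
    rintro ⟨v, hv⟩ ⟨w, hw⟩
    obtain ⟨u, hu⟩ := h₂ w
    exact ⟨u, hu.trans (congrArg f hw)⟩)

theorem lift_cls {d : Module.End R M} {e : Module.End R N} (f : M →ₗ[R] N)
    (h₁ : ∀ v, d v = 0 → e (f v) = 0) (h₂ : ∀ v, ∃ w, e w = f (d v)) (v : M) (hv : d v = 0) :
    lift f h₁ h₂ (cls d v hv) = cls e (f v) (h₁ v hv) := rfl

/-- The map on homology induced by a chain map. -/
def map {d : Module.End R M} {e : Module.End R N} (f : M →ₗ[R] N) (h : ∀ v, f (d v) = e (f v)) :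
    Homology d →ₗ[R] Homology e :=
  lift f (fun v hv => by rw [← h, hv, map_zero]) fun v => ⟨f v, (h v).symm⟩

end Homology

/-- The differential of the mapping cone of the endomorphism `ζ`. -/
def coneD (d ε ζ : Module.End R M) : Module.End R (M × M) :=
  LinearMap.prod (d ∘ₗ LinearMap.fst R M M + ζ ∘ₗ ε ∘ₗ LinearMap.snd R M M)
    (d ∘ₗ LinearMap.snd R M M)

theorem coneD_apply (d ε ζ : Module.End R M) (v : M × M) :
    coneD d ε ζ v = (d v.1 + ζ (ε v.2), d v.2) := rfl

variable {A : Type} [AddCommGroup A] [Module R A]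

/-- The homology of the cone of `ζ` is an extension of the homology of `ker ζ` by the homology of
`coker ζ`, both of which are `A`; that the connecting map vanishes is witnessed by the extension
`0 → M → N → A → 0` and by `p`. -/
theorem exists_exact_cone {d ε ζ : Module.End R M} {dN : Module.End R N} {dA εA : Module.End R A}
    (hεε : ∀ v, ε (ε v) = v)
    (hdd : ∀ v, dN (dN v) = 0) (hdM : ∀ v, d (d v) = 0)
    (hdε : ∀ v, d (ε v) = - ε (d v)) (hdεA : ∀ v, dA (εA v) = - εA (dA v))
    (ι : A →ₗ[R] M) (π : M →ₗ[R] A) (j : M →ₗ[R] N) (p : N →ₗ[R] M) (σ : N →ₗ[R] A)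
    (hι : Function.Injective ι) (hιζ : Function.Exact ι ζ) (hζπ : Function.Exact ζ π)
    (hπ : Function.Surjective π) (hj : Function.Injective j) (hjσ : Function.Exact j σ)
    (hσ : Function.Surjective σ) (hpj : ∀ v, p (j v) = ζ v) (hπp : ∀ v, π (p v) = σ v)
    (dι : ∀ v, ι (dA v) = d (ι v)) (dπ : ∀ v, π (d v) = dA (π v)) (dj : ∀ v, j (d v) = dN (j v))
    (dp : ∀ v, p (dN v) = d (p v)) (dσ : ∀ v, σ (dN v) = dA (σ v))
    (ει : ∀ v, ι (εA v) = ε (ι v)) :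
    ∃ (α : Homology dA →ₗ[R] Homology (coneD d ε ζ)) (β : Homology (coneD d ε ζ) →ₗ[R] Homology dA),
      Function.Injective α ∧ Function.Exact α β ∧ Function.Surjective β := by
  have dζ : ∀ v, ζ (d v) = d (ζ v) := fun v => by rw [← hpj, dj, dp, hpj]
  have ζι : ∀ a, ζ (ι a) = 0 := fun a => (hιζ _).2 ⟨a, rfl⟩
  have πζ : ∀ a, π (ζ a) = 0 := fun a => (hζπ _).2 ⟨a, rfl⟩
  have hlift : ∀ a, dA a = 0 → ∃ m b, π m = a ∧ d m = ζ b ∧ d b = 0 := by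
    intro a ha
    obtain ⟨n, rfl⟩ := hσ a
    obtain ⟨b, hb⟩ := (hjσ (dN n)).1 (by rw [dσ, ha])
    exact ⟨p n, b, hπp n, by rw [← dp, ← hb, hpj], hj (by rw [dj, hb, hdd, map_zero])⟩
  refine ⟨Homology.lift (LinearMap.inr R M M ∘ₗ ι) ?_ ?_,
    Homology.lift (π ∘ₗ LinearMap.fst R M M) ?_ ?_, ?_, ?_, ?_⟩
  · intro a ha
    simp [coneD_apply, ← ει, ζι, ← dι, ha]
  · intro a
    exact ⟨(0, ι a), by simp [coneD_apply, ← ει, ζι, ← dι]⟩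
  · rintro ⟨m₀, m₁⟩ h
    have h' : d m₀ + ζ (ε m₁) = 0 := congrArg Prod.fst h
    have := congrArg π h'
    rw [map_add, πζ, add_zero, dπ, map_zero] at this
    exact this
  · rintro ⟨m₀, m₁⟩
    exact ⟨π m₀, by simp [coneD_apply, πζ, dπ]⟩
  · refine (injective_iff_map_eq_zero _).2 fun x hx => ?_
    obtain ⟨a, ha, rfl⟩ := Homology.exists_cls x
    rw [Homology.lift_cls, Homology.cls_eq_zero] at hx
    obtain ⟨⟨m₀, m₁⟩, h⟩ := hx
    have h₀ : d m₀ + ζ (ε m₁) = 0 := congrArg Prod.fst h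
    have h₁ : d m₁ = ι a := congrArg Prod.snd h
    obtain ⟨m, b, hm, hdm, hdb⟩ := hlift (π m₀) (by
      have := congrArg π h₀
      rwa [map_add, πζ, add_zero, dπ, map_zero] at this)
    obtain ⟨e, he⟩ := (hζπ (m₀ - m)).1 (by rw [map_sub, hm, sub_self])
    obtain ⟨a', ha'⟩ := (hιζ (d e + ε m₁ + b)).1 (by
      rw [map_add, map_add, dζ, he, map_sub, hdm, ← h₀]; abel)
    refine Homology.cls_eq_zero.2 ⟨εA a', ?_⟩
    apply hι
    rw [hdεA, map_neg, ει, dι, ha', map_add, map_add, map_add, map_add, hdb, hdε, h₁, hdM]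
    simp [hεε]
  · intro x
    obtain ⟨⟨m₀, m₁⟩, hm, rfl⟩ := Homology.exists_cls x
    have h₀ : d m₀ + ζ (ε m₁) = 0 := congrArg Prod.fst hm
    have h₁ : d m₁ = 0 := congrArg Prod.snd hm
    constructor
    · intro hx
      rw [Homology.lift_cls, Homology.cls_eq_zero] at hx
      obtain ⟨a', ha'⟩ := hx
      obtain ⟨m', rfl⟩ := hπ a'
      obtain ⟨e, he⟩ := (hζπ (m₀ - d m')).1 (by
        rw [map_sub, dπ, ha']; simp)
      obtain ⟨a, ha⟩ := (hιζ (ε (m₁ - d (ε e)))).1 (by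
        rw [hdε, sub_neg_eq_add, map_add, hεε, map_add, dζ, he, map_sub, hdM, sub_zero, ← h₀,
          add_comm])
      have hm₁ : m₁ - d (ε e) = ι (εA a) := by rw [ει, ha, hεε]
      have hz : dA (εA a) = 0 := hι (by rw [dι, ← hm₁, map_sub, h₁, hdM, sub_zero, map_zero])
      refine ⟨Homology.cls dA (εA a) hz, ?_⟩
      rw [Homology.lift_cls, Homology.cls_eq_cls]
      refine ⟨(-m', - ε e), ?_⟩
      ext
      · simp [coneD_apply, hεε, he]; abel
      · simp [coneD_apply, ← hm₁]
    · rintro ⟨y, hy⟩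
      obtain ⟨a, ha, rfl⟩ := Homology.exists_cls y
      rw [← hy, Homology.lift_cls, Homology.lift_cls, Homology.cls_eq_zero]
      exact ⟨0, by simp⟩
  · intro x
    obtain ⟨a, ha, rfl⟩ := Homology.exists_cls x
    obtain ⟨m, b, rfl, hdm, hdb⟩ := hlift a ha
    refine ⟨Homology.cls _ (m, -ε b) ?_, ?_⟩
    · ext <;> simp [coneD_apply, hdm, hεε, hdε, hdb]
    · rfl

end Homology

section KoszulModule

variable {R M N : Type} [CommRing R] [AddCommGroup M] [Module R M] [AddCommGroup N] [Module R N]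
  {r : ℕ}

/-- The differential of the Koszul complex `K(z) ⊗ M` of a module. -/
def koszulEnd (z : Fin r → R) (M : Type) [AddCommGroup M] [Module R M] :
    Module.End R (Finset (Fin r) → M) where
  toFun f t := ∑ i ∈ tᶜ, (ksign i t * z i : R) • f (insert i t)
  map_add' f g := by funext t; simp [Finset.sum_add_distrib]
  map_smul' c f := by
    funext t
    simp only [Pi.smul_apply, RingHom.id_apply, Finset.smul_sum]
    exact Finset.sum_congr rfl fun i _ => smul_comm _ _ _

theorem koszulEnd_apply (z : Fin r → R) (f : Finset (Fin r) → M) (t : Finset (Fin r)) :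
    koszulEnd z M f t = ∑ i ∈ tᶜ, (ksign i t * z i : R) • f (insert i t) := rfl

/-- The involution of the Koszul complex acting by `(-1)^q` in exterior degree `q`. -/
def koszulInvol (R : Type) [CommRing R] (r : ℕ) (M : Type) [AddCommGroup M] [Module R M] :
    Module.End R (Finset (Fin r) → M) where
  toFun f t := (-1 : R) ^ t.card • f t
  map_add' f g := by funext t; simp
  map_smul' c f := by funext t; exact smul_comm _ _ _

theorem koszulInvol_apply (f : Finset (Fin r) → M) (t : Finset (Fin r)) :
    koszulInvol R r M f t = (-1 : R) ^ t.card • f t := rfl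

theorem koszulInvol_koszulInvol (f : Finset (Fin r) → M) :
    koszulInvol R r M (koszulInvol R r M f) = f := by
  funext t
  rw [koszulInvol_apply, koszulInvol_apply, smul_smul, ← mul_pow]
  simp

theorem koszulEnd_koszulInvol (z : Fin r → R) (f : Finset (Fin r) → M) :
    koszulEnd z M (koszulInvol R r M f) = - koszulInvol R r M (koszulEnd z M f) := by
  funext t
  rw [Pi.neg_apply, koszulInvol_apply, koszulEnd_apply, koszulEnd_apply, Finset.smul_sum,
    ← Finset.sum_neg_distrib]
  refine Finset.sum_congr rfl fun i hi => ?_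
  rw [koszulInvol_apply, Finset.card_insert_of_notMem (Finset.mem_compl.1 hi), pow_succ]
  module

/-- Functoriality of the Koszul complex in the module. -/
def koszulMap (r : ℕ) (f : M →ₗ[R] N) : (Finset (Fin r) → M) →ₗ[R] (Finset (Fin r) → N) :=
  f.compLeft _

theorem koszulMap_apply (f : M →ₗ[R] N) (v : Finset (Fin r) → M) (t : Finset (Fin r)) :
    koszulMap r f v t = f (v t) := rfl

theorem koszulMap_koszulEnd (z : Fin r → R) (f : M →ₗ[R] N) (v : Finset (Fin r) → M) :
    koszulMap r f (koszulEnd z M v) = koszulEnd z N (koszulMap r f v) := by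
  funext t
  simp [koszulMap_apply, koszulEnd_apply]

theorem koszulMap_koszulInvol (f : M →ₗ[R] N) (v : Finset (Fin r) → M) :
    koszulMap r f (koszulInvol R r M v) = koszulInvol R r N (koszulMap r f v) := by
  funext t
  simp [koszulMap_apply, koszulInvol_apply]

theorem koszulMap_injective {f : M →ₗ[R] N} (hf : Function.Injective f) :
    Function.Injective (koszulMap r f) := fun _ _ h =>
  funext fun t => hf (congrFun h t)

theorem koszulMap_surjective {f : M →ₗ[R] N} (hf : Function.Surjective f) :
    Function.Surjective (koszulMap r f) := fun v => by
  choose w hw using fun t => hf (v t)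
  exact ⟨w, funext hw⟩

theorem koszulMap_exact {P : Type} [AddCommGroup P] [Module R P] {f : M →ₗ[R] N} {g : N →ₗ[R] P}
    (h : Function.Exact f g) : Function.Exact (koszulMap r f) (koszulMap r g) := by
  refine fun v => ⟨fun hv => ?_, ?_⟩
  · choose w hw using fun t => (h (v t)).1 (congrFun hv t)
    exact ⟨w, funext hw⟩
  · rintro ⟨w, rfl⟩
    exact funext fun t => (h _).2 ⟨w t, rfl⟩

/-- A subset of the first `r` indices, as a subset of `r + 1` indices. -/
def lowSet (t : Finset (Fin r)) : Finset (Fin (r + 1)) := t.map Fin.castSuccEmb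

@[simp] theorem castSucc_mem_lowSet {t : Finset (Fin r)} {i : Fin r} :
    i.castSucc ∈ lowSet t ↔ i ∈ t := by simp [lowSet]

@[simp] theorem last_notMem_lowSet {t : Finset (Fin r)} : Fin.last r ∉ lowSet t := by
  simp [lowSet]

/-- The trace of a subset on the first `r` indices. -/
def lowPart (s : Finset (Fin (r + 1))) : Finset (Fin r) := Finset.univ.filter (·.castSucc ∈ s)

theorem lowPart_lowSet (t : Finset (Fin r)) : lowPart (lowSet t) = t := by
  ext; simp [lowPart]

theorem lowPart_insert (t : Finset (Fin r)) : lowPart (insert (Fin.last r) (lowSet t)) = t := by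
  ext; simp [lowPart]

theorem lowSet_lowPart {s : Finset (Fin (r + 1))} (h : Fin.last r ∉ s) :
    lowSet (lowPart s) = s := by
  ext i
  induction i using Fin.lastCases with
  | last => simp [h]
  | cast i => simp [lowPart]

theorem insert_lowSet_lowPart {s : Finset (Fin (r + 1))} (h : Fin.last r ∈ s) :
    insert (Fin.last r) (lowSet (lowPart s)) = s := by
  ext i
  induction i using Fin.lastCases with
  | last => simp [h]
  | cast i => simp [lowPart]

/-- The Koszul complex on `r + 1` elements splits into the parts without and with the last
exterior generator. -/
def koszulSplit (R : Type) [CommRing R] (r : ℕ) (M : Type) [AddCommGroup M] [Module R M] :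
    (Finset (Fin (r + 1)) → M) ≃ₗ[R] (Finset (Fin r) → M) × (Finset (Fin r) → M) where
  toFun f := (fun t => f (lowSet t), fun t => f (insert (Fin.last r) (lowSet t)))
  map_add' _ _ := rfl
  map_smul' _ _ := rfl
  invFun g s := if Fin.last r ∈ s then g.2 (lowPart s) else g.1 (lowPart s)
  left_inv f := by
    funext s
    by_cases h : Fin.last r ∈ s
    · simp [h, insert_lowSet_lowPart h]
    · simp [h, lowSet_lowPart h]
  right_inv g := by
    ext t <;> simp [lowPart_lowSet, lowPart_insert]

theorem ksign_castSucc_lowSet (i : Fin r) (t : Finset (Fin r)) :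
    (ksign i.castSucc (lowSet t) : R) = ksign i t := by
  rw [ksign, ksign, lowSet, Finset.filter_map, Finset.card_map]
  rfl

theorem ksign_castSucc_insert (i : Fin r) (t : Finset (Fin r)) :
    (ksign i.castSucc (insert (Fin.last r) (lowSet t)) : R) = ksign i t := by
  rw [← ksign_castSucc_lowSet i t, ksign, ksign, Finset.filter_insert,
    if_neg (by simp [Fin.le_last])]

theorem ksign_last_lowSet (t : Finset (Fin r)) :
    (ksign (Fin.last r) (lowSet t) : R) = (-1) ^ t.card := by
  rw [ksign, Finset.filter_true_of_mem, lowSet, Finset.card_map]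
  intro j hj
  exact Fin.lt_last_iff_ne_last.2 fun h => last_notMem_lowSet (h ▸ hj)

theorem lowSet_insert (i : Fin r) (t : Finset (Fin r)) :
    lowSet (insert i t) = insert i.castSucc (lowSet t) := by
  simp [lowSet, Finset.map_insert]

theorem compl_lowSet (t : Finset (Fin r)) :
    (lowSet t)ᶜ = insert (Fin.last r) (lowSet tᶜ) := by
  ext i
  induction i using Fin.lastCases <;> simp

theorem compl_insert_lowSet (t : Finset (Fin r)) :
    (insert (Fin.last r) (lowSet t))ᶜ = lowSet tᶜ := by
  ext i
  induction i using Fin.lastCases <;> simp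

theorem sum_lowSet (t : Finset (Fin r)) (f : Fin (r + 1) → M) :
    ∑ i ∈ lowSet t, f i = ∑ i ∈ t, f i.castSucc := by
  simp [lowSet]

theorem koszulSplit_koszulEnd (z : Fin (r + 1) → R) (f : Finset (Fin (r + 1)) → M) :
    koszulSplit R r M (koszulEnd z M f) =
      coneD (koszulEnd (fun i => z i.castSucc) M) (koszulInvol R r M)
        (koszulMap r (LinearMap.lsmul R M (z (Fin.last r)))) (koszulSplit R r M f) := by
  ext t
  · change koszulEnd z M f (lowSet t) = _ + _
    rw [koszulEnd_apply, compl_lowSet, Finset.sum_insert last_notMem_lowSet, add_comm, sum_lowSet]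
    congr 1
    · exact Finset.sum_congr rfl fun i _ => by rw [ksign_castSucc_lowSet, ← lowSet_insert]; rfl
    · rw [ksign_last_lowSet, mul_comm, mul_smul]; rfl
  · change koszulEnd z M f (insert (Fin.last r) (lowSet t)) = _
    rw [koszulEnd_apply, compl_insert_lowSet, sum_lowSet]
    refine Finset.sum_congr rfl fun i _ => ?_
    rw [ksign_castSucc_insert, Finset.insert_comm, ← lowSet_insert]; rfl

theorem koszulEnd_koszulEnd (z : Fin r → R) (f : Finset (Fin r) → M) :
    koszulEnd z M (koszulEnd z M f) = 0 := by
  induction r with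
  | zero => funext t; simp [koszulEnd_apply, Subsingleton.elim tᶜ ∅]
  | succ r ih =>
    apply (koszulSplit R r M).injective
    rw [koszulSplit_koszulEnd, koszulSplit_koszulEnd, map_zero]
    ext : 1
    · simp [coneD_apply, ih, koszulEnd_koszulInvol, ← koszulMap_koszulEnd]
    · simp [coneD_apply, ih]

/-- All Koszul homology of `M` with respect to `z` is projective over `k`. -/
def ProjectiveKoszul {k : Type} [CommRing k] (φ : k →+* R) (z : Fin r → R) (M : Type)
    [AddCommGroup M] [Module R M] : Prop :=
  ProjectiveOver φ (Homology (koszulEnd z M))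

variable {k : Type} [CommRing k] {φ : k →+* R}

theorem ProjectiveKoszul.of_isSummandOf {N₁ N₂ : Type} [AddCommGroup N₁] [Module R N₁]
    [AddCommGroup N₂] [Module R N₂] {z : Fin r → R} (h₁ : ProjectiveKoszul φ z N₁)
    (h₂ : ProjectiveKoszul φ z N₂) (h : IsSummandOf R M N₁ N₂) : ProjectiveKoszul φ z M := by
  obtain ⟨f₁, g₁, f₂, g₂, h⟩ := h
  refine (ProjectiveOver.prod h₁ h₂).of_retract
    ((Homology.map _ (koszulMap_koszulEnd z f₁)).prod (Homology.map _ (koszulMap_koszulEnd z f₂)))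
    ((Homology.map _ (koszulMap_koszulEnd z g₁)).coprod
      (Homology.map _ (koszulMap_koszulEnd z g₂))) fun x => ?_
  obtain ⟨v, hv, rfl⟩ := Homology.exists_cls x
  change Homology.cls _ (koszulMap r g₁ (koszulMap r f₁ v) + koszulMap r g₂ (koszulMap r f₂ v)) _ = _
  congr 1
  exact funext fun t => h (v t)

theorem ProjectiveKoszul.succ {A : Type} [AddCommGroup A] [Module R A] {z : Fin (r + 1) → R}
    (ι : A →ₗ[R] M) (π : M →ₗ[R] A) (j : M →ₗ[R] N) (p : N →ₗ[R] M) (σ : N →ₗ[R] A)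
    (hι : Function.Injective ι) (hιζ : Function.Exact ι (LinearMap.lsmul R M (z (Fin.last r))))
    (hζπ : Function.Exact (LinearMap.lsmul R M (z (Fin.last r))) π)
    (hπ : Function.Surjective π) (hj : Function.Injective j) (hjσ : Function.Exact j σ)
    (hσ : Function.Surjective σ) (hpj : ∀ v, p (j v) = z (Fin.last r) • v)
    (hπp : ∀ v, π (p v) = σ v)
    (h : ProjectiveKoszul φ (fun i => z i.castSucc) A) : ProjectiveKoszul φ z M := by
  obtain ⟨α, β, hα, hαβ, hβ⟩ := exists_exact_cone
    (ζ := koszulMap r (LinearMap.lsmul R M (z (Fin.last r))))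
    (koszulInvol_koszulInvol (R := R) (r := r) (M := M))
    (koszulEnd_koszulEnd (M := N) fun i => z i.castSucc)
    (koszulEnd_koszulEnd (M := M) fun i => z i.castSucc)
    (koszulEnd_koszulInvol (M := M) fun i => z i.castSucc)
    (koszulEnd_koszulInvol (M := A) fun i => z i.castSucc)
    (koszulMap r ι) (koszulMap r π) (koszulMap r j) (koszulMap r p) (koszulMap r σ)
    (koszulMap_injective hι) (koszulMap_exact hιζ) (koszulMap_exact hζπ) (koszulMap_surjective hπ)
    (koszulMap_injective hj) (koszulMap_exact hjσ) (koszulMap_surjective hσ)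
    (fun v => funext fun t => hpj (v t)) (fun v => funext fun t => hπp (v t))
    (koszulMap_koszulEnd _ _) (koszulMap_koszulEnd _ _) (koszulMap_koszulEnd _ _)
    (koszulMap_koszulEnd _ _) (koszulMap_koszulEnd _ _) (koszulMap_koszulInvol _)
  refine (ProjectiveOver.of_exact h h α β hα hαβ hβ).of_retract
    (Homology.map (koszulSplit R r M).toLinearMap (koszulSplit_koszulEnd z))
    (Homology.map (koszulSplit R r M).symm.toLinearMap fun v => ?_) fun x => ?_
  · apply (koszulSplit R r M).injective
    simp [koszulSplit_koszulEnd]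
  · obtain ⟨v, hv, rfl⟩ := Homology.exists_cls x
    change Homology.cls _ ((koszulSplit R r M).symm (koszulSplit R r M v)) _ = _
    congr 1
    simp

end KoszulModule

section Words

/-- A property of words in the generators of the symmetric group which is inherited along
commutations of distant letters, duplication of letters and (split) braid relations. -/
structure BraidClosed (Q : List ℕ → Prop) : Prop where
  comm : ∀ U V i j, i + 1 < j ∨ j + 1 < i → Q (U ++ i :: j :: V) → Q (U ++ j :: i :: V)
  dup : ∀ U V i, Q (U ++ i :: V) → Q (U ++ i :: i :: V)
  braid : ∀ U V i, Q (U ++ i :: (i + 1) :: i :: V) → Q (U ++ (i + 1) :: V) →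
    Q (U ++ (i + 1) :: i :: (i + 1) :: V)

namespace BraidClosed

variable {Q : List ℕ → Prop}

theorem context (h : BraidClosed Q) (A B : List ℕ) : BraidClosed fun W => Q (A ++ W ++ B) where
  comm U V i j hij := by simpa using h.comm (A ++ U) (V ++ B) i j hij
  dup U V i := by simpa using h.dup (A ++ U) (V ++ B) i
  braid U V i := by simpa using h.braid (A ++ U) (V ++ B) i

theorem move_left (h : BraidClosed Q) {n : ℕ} {P : List ℕ} (hP : ∀ a ∈ P, a + 1 < n) :
    ∀ U V, Q (U ++ P ++ n :: V) → Q (U ++ n :: (P ++ V)) := by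
  induction P with
  | nil => simp
  | cons a P ih =>
    intro U V hQ
    refine h.comm U (P ++ V) a n (.inl (hP a (by simp))) ?_
    simpa using ih (fun b hb => hP b (by simp [hb])) (U ++ [a]) V (by simpa using hQ)

theorem move_right (h : BraidClosed Q) {n : ℕ} {P : List ℕ} (hP : ∀ a ∈ P, a + 1 < n) :
    ∀ U V, Q (U ++ n :: (P ++ V)) → Q (U ++ P ++ n :: V) := by
  induction P with
  | nil => simp
  | cons a P ih =>
    intro U V hQ
    simpa using ih (fun b hb => hP b (by simp [hb])) (U ++ [a]) V
      (by simpa using h.comm U (P ++ V) n a (.inr (hP a (by simp))) (by simpa using hQ))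

/-- A word in which `n` occurs twice contains two consecutive occurrences of `n`. -/
theorem _root_.List.exists_eq_of_one_lt_count {n : ℕ} {W : List ℕ} (h : 1 < W.count n) :
    ∃ U P V, W = U ++ n :: (P ++ n :: V) ∧ n ∉ P := by
  have hn : n ∈ W := List.count_pos_iff.1 (by omega)
  obtain ⟨U, W', rfl, hU⟩ := List.eq_append_cons_of_mem hn
  have hn' : n ∈ W' := by
    refine List.count_pos_iff.1 ?_
    rw [List.count_append, List.count_cons_self, List.count_eq_zero.2 hU] at h
    omega
  obtain ⟨P, V, rfl, hP⟩ := List.eq_append_cons_of_mem hn'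
  exact ⟨U, P, V, rfl, hP⟩

/-- A braid closed property of words in the letters `< n` only has to be checked when the last
letter `n - 1` occurs at most once. -/
theorem of_count_le_one (n : ℕ) : ∀ {Q : List ℕ → Prop}, BraidClosed Q →
    (∀ W : List ℕ, (∀ a ∈ W, a < n) → W.count (n - 1) ≤ 1 → Q W) →
    ∀ W : List ℕ, (∀ a ∈ W, a < n) → Q W := by
  induction n with
  | zero =>
    intro Q _ hQ W hW
    exact hQ W hW (by
      cases W with
      | nil => simp
      | cons a W => exact absurd (hW a (by simp)) (by simp))
  | succ n ih =>
    intro Q h hQ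
    have main : ∀ c, ∀ W : List ℕ, W.count n = c → (∀ a ∈ W, a < n + 1) → Q W := by
      intro c
      induction c using Nat.strong_induction_on with
      | _ c hc =>
      intro W hWc hW
      by_cases h1 : W.count n ≤ 1
      · exact hQ W hW h1
      obtain ⟨U, P, V, rfl, hP⟩ := List.exists_eq_of_one_lt_count (not_le.1 h1)
      simp only [List.mem_append, List.mem_cons] at hW
      simp only [List.count_append, List.count_cons_self, List.count_eq_zero.2 hP] at hWc
      have hdup : ∀ W : List ℕ, (∀ a ∈ W, a + 1 < n) → Q (U ++ n :: (W ++ n :: V)) := by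
        intro W hWn
        refine h.move_left hWn U (n :: V) (h.dup (U ++ W) V n ?_)
        have : List.count n W = 0 := List.count_eq_zero.2 fun hn => by
          have := hWn n hn
          omega
        refine hc _ ?_ _ rfl ?_
        · simp only [List.count_append, List.count_cons_self, this]
          omega
        · intro a ha
          simp only [List.mem_append, List.mem_cons] at ha
          have := hWn a
          have := hW a
          grind
      have key := ih (h.context (U ++ [n]) (n :: V)) (fun W hWn hcount => ?_) P (fun a ha => by
        have := hW a (by simp [ha])
        have : a ≠ n := fun e => hP (e ▸ ha)
        omega)
      · simpa using key
      suffices Q (U ++ n :: (W ++ n :: V)) by simpa using this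
      by_cases hmem : n - 1 ∈ W
      · have hn : n - 1 + 1 = n := by
          have := hWn _ hmem
          omega
        obtain ⟨A, B, rfl, hA⟩ := List.eq_append_cons_of_mem hmem
        have hB : n - 1 ∉ B := by
          rw [List.count_append, List.count_cons_self] at hcount
          exact List.count_eq_zero.1 (by omega)
        have hA' : ∀ a ∈ A, a + 1 < n := fun a ha => by
          have := hWn a (by simp [ha])
          have : a ≠ n - 1 := fun e => hA (e ▸ ha)
          omega
        have hB' : ∀ a ∈ B, a + 1 < n := fun a ha => by
          have := hWn a (by simp [ha])
          have : a ≠ n - 1 := fun e => hB (e ▸ ha)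
          omega
        have hAn : List.count n A = 0 := List.count_eq_zero.2 fun hn => by
          have := hA' n hn
          omega
        have hBn : List.count n B = 0 := List.count_eq_zero.2 fun hn => by
          have := hB' n hn
          omega
        have hne : (n - 1 == n) = false := by simp; omega
        have hbraid := h.braid (U ++ A) (B ++ V) (n - 1)
        rw [hn] at hbraid
        have goal := hbraid (hc _ ?_ _ rfl ?_) (hc _ ?_ _ rfl ?_)
        · have := h.move_right hB' (U ++ A ++ [n, n - 1]) V (by simpa using goal)
          simpa using h.move_left hA' U ((n - 1) :: (B ++ n :: V)) (by simpa using this)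
        · simp only [List.count_append, List.count_cons, hAn, hBn, hne]
          simp
          omega
        · intro a ha
          simp only [List.mem_append, List.mem_cons] at ha
          have := hA' a
          have := hB' a
          have := hW a
          grind
        · simp only [List.count_append, List.count_cons_self, hAn, hBn]
          omega
        · intro a ha
          simp only [List.mem_append, List.mem_cons] at ha
          have := hA' a
          have := hB' a
          have := hW a
          grind
      · refine hdup W fun a ha => ?_
        have := hWn a ha
        have : a ≠ n - 1 := fun e => hmem (e ▸ ha)
        omega
    exact fun W hW => main _ W rfl hW

end BraidClosed

end Words

section MainInduction

variable {k : Type} [CommRing k]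

/-- The module `M ⊗ B_{i_1} ⊗ ⋯ ⊗ B_{i_l}`. -/
def crossings (J : List ℕ) (M : ModuleCat.{0} (MvPolynomial ℕ k)) :
    ModuleCat.{0} (MvPolynomial ℕ k) :=
  J.foldl (fun M i => ModuleCat.of (MvPolynomial ℕ k) (Crossing i M)) M

theorem crossings_append (U V : List ℕ) (M : ModuleCat.{0} (MvPolynomial ℕ k)) :
    crossings (U ++ V) M = crossings V (crossings U M) :=
  List.foldl_append

theorem crossings_cons (i : ℕ) (V : List ℕ) (M : ModuleCat.{0} (MvPolynomial ℕ k)) :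
    crossings (i :: V) M = crossings V (ModuleCat.of (MvPolynomial ℕ k) (Crossing i M)) := rfl

theorem IsSummandOf.crossings (J : List ℕ) : ∀ {M N₁ N₂ : ModuleCat.{0} (MvPolynomial ℕ k)},
    IsSummandOf (MvPolynomial ℕ k) M N₁ N₂ →
    IsSummandOf (MvPolynomial ℕ k) (crossings J M) (crossings J N₁) (crossings J N₂) := by
  induction J with
  | nil => exact fun h => h
  | cons i J ih =>
    intro M N₁ N₂ h
    exact ih (M := ModuleCat.of (MvPolynomial ℕ k) (Crossing i M))
      (N₁ := ModuleCat.of (MvPolynomial ℕ k) (Crossing i N₁))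
      (N₂ := ModuleCat.of (MvPolynomial ℕ k) (Crossing i N₂)) (h.crossing i)

theorem Crossing.map_injective {M N : Type} [AddCommGroup M] [Module (MvPolynomial ℕ k) M]
    [AddCommGroup N] [Module (MvPolynomial ℕ k) N] (i : ℕ) {f : M →ₗ[MvPolynomial ℕ k] N}
    (hf : Function.Injective f) : Function.Injective (Crossing.map i f) := fun _ _ h =>
  Crossing.ext (hf (congrArg Crossing.fst h)) (hf (congrArg Crossing.snd h))

theorem Crossing.map_surjective {M N : Type} [AddCommGroup M] [Module (MvPolynomial ℕ k) M]
    [AddCommGroup N] [Module (MvPolynomial ℕ k) N] (i : ℕ) {f : M →ₗ[MvPolynomial ℕ k] N}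
    (hf : Function.Surjective f) : Function.Surjective (Crossing.map i f) := fun v => by
  obtain ⟨a, ha⟩ := hf (Crossing.fst v)
  obtain ⟨b, hb⟩ := hf (Crossing.snd v)
  exact ⟨Crossing.mk a b, Crossing.ext ha hb⟩

theorem Crossing.map_exact {M N P : Type} [AddCommGroup M] [Module (MvPolynomial ℕ k) M]
    [AddCommGroup N] [Module (MvPolynomial ℕ k) N] [AddCommGroup P] [Module (MvPolynomial ℕ k) P]
    (i : ℕ) {f : M →ₗ[MvPolynomial ℕ k] N} {g : N →ₗ[MvPolynomial ℕ k] P}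
    (h : Function.Exact f g) : Function.Exact (Crossing.map i f) (Crossing.map i g) := by
  refine fun v => ⟨fun hv => ?_, ?_⟩
  · obtain ⟨a, ha⟩ := (h (Crossing.fst v)).1 (congrArg Crossing.fst hv)
    obtain ⟨b, hb⟩ := (h (Crossing.snd v)).1 (congrArg Crossing.snd hv)
    exact ⟨Crossing.mk a b, Crossing.ext ha hb⟩
  · rintro ⟨w, rfl⟩
    exact Crossing.ext ((h _).2 ⟨_, rfl⟩) ((h _).2 ⟨_, rfl⟩)

/-- Functoriality of `crossings`. -/
def crossingsMap : ∀ (J : List ℕ) {M N : ModuleCat.{0} (MvPolynomial ℕ k)}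
    (_ : M →ₗ[MvPolynomial ℕ k] N), crossings J M →ₗ[MvPolynomial ℕ k] crossings J N
  | [], _, _, f => f
  | i :: J, M, N, f => crossingsMap J (M := ModuleCat.of (MvPolynomial ℕ k) (Crossing i M))
      (N := ModuleCat.of (MvPolynomial ℕ k) (Crossing i N)) (Crossing.map i f)

theorem crossingsMap_injective (J : List ℕ) : ∀ {M N : ModuleCat.{0} (MvPolynomial ℕ k)}
    {f : M →ₗ[MvPolynomial ℕ k] N}, Function.Injective f →
    Function.Injective (crossingsMap J f) := by
  induction J with
  | nil => exact fun h => h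
  | cons i J ih => exact fun h => ih (Crossing.map_injective i h)

theorem crossingsMap_surjective (J : List ℕ) : ∀ {M N : ModuleCat.{0} (MvPolynomial ℕ k)}
    {f : M →ₗ[MvPolynomial ℕ k] N}, Function.Surjective f →
    Function.Surjective (crossingsMap J f) := by
  induction J with
  | nil => exact fun h => h
  | cons i J ih => exact fun h => ih (Crossing.map_surjective i h)

theorem crossingsMap_exact (J : List ℕ) : ∀ {M N P : ModuleCat.{0} (MvPolynomial ℕ k)}
    {f : M →ₗ[MvPolynomial ℕ k] N} {g : N →ₗ[MvPolynomial ℕ k] P}, Function.Exact f g →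
    Function.Exact (crossingsMap J f) (crossingsMap J g) := by
  induction J with
  | nil => exact fun h => h
  | cons i J ih => exact fun h => ih (Crossing.map_exact i h)

theorem crossingsMap_comp (J : List ℕ) : ∀ {M N P : ModuleCat.{0} (MvPolynomial ℕ k)}
    (f : M →ₗ[MvPolynomial ℕ k] N) (g : N →ₗ[MvPolynomial ℕ k] P) (v : crossings J M),
    crossingsMap J g (crossingsMap J f v) = crossingsMap J (g ∘ₗ f) v := by
  induction J with
  | nil => exact fun _ _ _ => rfl
  | cons i J ih =>
    exact fun {M N P} f g v => ih (M := ModuleCat.of (MvPolynomial ℕ k) (Crossing i M))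
      (N := ModuleCat.of (MvPolynomial ℕ k) (Crossing i N))
      (P := ModuleCat.of (MvPolynomial ℕ k) (Crossing i P)) (Crossing.map i f) (Crossing.map i g) v

theorem crossingsMap_lsmul {r : ℕ} (c : k) {J : List ℕ} : (∀ a ∈ J, a + 1 < r) →
    ∀ (M : ModuleCat.{0} (MvPolynomial ℕ k)),
    crossingsMap J (LinearMap.lsmul (MvPolynomial ℕ k) M (C c - X r)) =
      LinearMap.lsmul (MvPolynomial ℕ k) (crossings J M) (C c - X r) := by
  induction J with
  | nil => exact fun _ _ => rfl
  | cons i J ih =>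
    intro hJ M
    refine Eq.trans ?_ (ih (fun a ha => hJ a (by simp [ha]))
      (ModuleCat.of (MvPolynomial ℕ k) (Crossing i M)))
    refine congrArg (crossingsMap J (M := ModuleCat.of (MvPolynomial ℕ k) (Crossing i M))
      (N := ModuleCat.of (MvPolynomial ℕ k) (Crossing i M))) (LinearMap.ext fun v => ?_)
    have := hJ i (by simp)
    refine Crossing.ext ?_ ?_
    · change (C c - X r : MvPolynomial ℕ k) • Crossing.fst v =
        Crossing.fst ((C c - X r : MvPolynomial ℕ k) • v)
      simp [sub_smul]
    · change (C c - X r : MvPolynomial ℕ k) • Crossing.snd v =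
        Crossing.snd ((C c - X r : MvPolynomial ℕ k) • v)
      simp [sub_smul, Crossing.snd_X_of_ne (show r ≠ i by omega) (show r ≠ i + 1 by omega)]

/-- The ring `k` as a module, with `X n` acting by `x n`. -/
def BaseModule (_x : ℕ → k) : Type := k

instance (x : ℕ → k) : AddCommGroup (BaseModule x) := inferInstanceAs (AddCommGroup k)

instance (x : ℕ → k) : Module (MvPolynomial ℕ k) (BaseModule x) :=
  Module.compHom k (eval₂Hom (RingHom.id k) x)

/-- The module `M ⊕ M δ ⊕ M δ²` with `δ³ = (X (i+1) - X i) δ²`. -/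
def CubicCrossing (_i : ℕ) (M : Type) : Type := M × M × M

namespace CubicCrossing

variable (i : ℕ) {M : Type} [AddCommGroup M] [Module (MvPolynomial ℕ k) M]

instance : AddCommGroup (CubicCrossing i M) := inferInstanceAs (AddCommGroup (M × M × M))

/-- Multiplication by `δ`. -/
def delta (k : Type) [CommRing k] (i : ℕ) (M : Type) [AddCommGroup M]
    [Module (MvPolynomial ℕ k) M] : Module.End (MvPolynomial ℕ k) (M × M × M) :=
  LinearMap.prod 0 (LinearMap.prod (LinearMap.fst _ M (M × M))
    ((LinearMap.fst _ M M + (X (i + 1) - X i : MvPolynomial ℕ k) • LinearMap.snd _ M M) ∘ₗ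
      LinearMap.snd _ M (M × M)))

instance : Module (MvPolynomial ℕ k) (CubicCrossing i M) :=
  Module.compHom (M × M × M) (twistAction (delta k i M) (crossingSign i))

variable {i}

/-- The element `a + b δ + c δ²`. -/
def mk (a b c : M) : CubicCrossing i M := (a, b, c)

/-- The coefficient of `1`. -/
def c₀ : CubicCrossing i M →+ M := AddMonoidHom.fst M (M × M)

/-- The coefficient of `δ`. -/
def c₁ : CubicCrossing i M →+ M := (AddMonoidHom.fst M M).comp (AddMonoidHom.snd M (M × M))

/-- The coefficient of `δ²`. -/
def c₂ : CubicCrossing i M →+ M := (AddMonoidHom.snd M M).comp (AddMonoidHom.snd M (M × M))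

@[simp] theorem c₀_mk (a b c : M) : c₀ (mk a b c : CubicCrossing i M) = a := rfl
@[simp] theorem c₁_mk (a b c : M) : c₁ (mk a b c : CubicCrossing i M) = b := rfl
@[simp] theorem c₂_mk (a b c : M) : c₂ (mk a b c : CubicCrossing i M) = c := rfl

@[ext] theorem ext {v w : CubicCrossing i M} (h₀ : c₀ v = c₀ w) (h₁ : c₁ v = c₁ w)
    (h₂ : c₂ v = c₂ w) : v = w :=
  Prod.ext h₀ (Prod.ext h₁ h₂)

theorem C_smul (a : k) (v : CubicCrossing i M) : (C a : MvPolynomial ℕ k) • v =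
    mk ((C a : MvPolynomial ℕ k) • c₀ v) ((C a : MvPolynomial ℕ k) • c₁ v)
      ((C a : MvPolynomial ℕ k) • c₂ v) :=
  twistAction_C (delta k i M) (crossingSign i) a v

theorem X_smul (n : ℕ) (v : CubicCrossing i M) : (X n : MvPolynomial ℕ k) • v =
    mk ((X n : MvPolynomial ℕ k) • c₀ v)
      ((X n : MvPolynomial ℕ k) • c₁ v + crossingSign i n • c₀ v)
      ((X n : MvPolynomial ℕ k) • c₂ v +
        crossingSign i n • (c₁ v + (X (i + 1) - X i : MvPolynomial ℕ k) • c₂ v)) :=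
  (twistAction_X (delta k i M) (crossingSign i) n v).trans
    (Prod.ext (show (X n : MvPolynomial ℕ k) • c₀ v + crossingSign i n • (0 : M) = _ by simp; rfl)
      rfl)

end CubicCrossing

open CubicCrossing (c₀ c₁ c₂) in
open Crossing in
/-- A crossing involving the last strand, on which `X r` acts as the scalar `c` beforehand, can be
removed together with that strand. -/
theorem exists_crossing_resolution {i r : ℕ} (hi : i + 1 = r) (c : k) (B : Type) [AddCommGroup B]
    [Module (MvPolynomial ℕ k) B]
    (hB : ∀ v : B, (X r : MvPolynomial ℕ k) • v = (C c : MvPolynomial ℕ k) • v) :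
    ∃ (ι : B →ₗ[MvPolynomial ℕ k] Crossing i B) (π : Crossing i B →ₗ[MvPolynomial ℕ k] B)
      (j : Crossing i B →ₗ[MvPolynomial ℕ k] CubicCrossing i B)
      (p : CubicCrossing i B →ₗ[MvPolynomial ℕ k] Crossing i B)
      (σ : CubicCrossing i B →ₗ[MvPolynomial ℕ k] B),
      Function.Injective ι ∧
      Function.Exact ι (LinearMap.lsmul (MvPolynomial ℕ k) (Crossing i B) (C c - X r)) ∧
      Function.Exact (LinearMap.lsmul (MvPolynomial ℕ k) (Crossing i B) (C c - X r)) π ∧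
      Function.Surjective π ∧ Function.Injective j ∧ Function.Exact j σ ∧
      Function.Surjective σ ∧
      p ∘ₗ j = LinearMap.lsmul (MvPolynomial ℕ k) (Crossing i B) (C c - X r) ∧ π ∘ₗ p = σ := by
  subst hi
  have hζ : ∀ v : Crossing i B, (C c - X (i + 1) : MvPolynomial ℕ k) • v =
      mk 0 (fst v + (X (i + 1) - X i : MvPolynomial ℕ k) • snd v) := by
    intro v
    ext
    · simp [sub_smul, hB]
    · simp [sub_smul, snd_X_succ, hB]
      abel
  obtain ⟨ι, hι⟩ := exists_linearMap (k := k) (M := B) (N₁ := Crossing i B)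
    (fun b => mk ((X i - X (i + 1) : MvPolynomial ℕ k) • b) b)
    (fun v w => by ext <;> simp) (fun a v => by ext <;> simp <;> module)
    (fun n v => by
      ext
      · simp; module
      · simp [snd_X]; module)
  obtain ⟨π, hπ⟩ := exists_linearMap (k := k) (M := Crossing i B) (N₁ := B)
    (fun v => fst v) (fun v w => by simp) (fun a v => by simp) (fun n v => by simp)
  obtain ⟨j, hj⟩ := exists_linearMap (k := k) (M := Crossing i B) (N₁ := CubicCrossing i B)
    (fun v => CubicCrossing.mk 0 (fst v) (snd v)) (fun v w => by ext <;> simp)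
    (fun a v => by ext <;> simp [CubicCrossing.C_smul])
    (fun n v => by ext <;> simp [CubicCrossing.X_smul, snd_X])
  obtain ⟨p, hp⟩ := exists_linearMap (k := k) (M := CubicCrossing i B) (N₁ := Crossing i B)
    (fun v => mk (c₀ v) (c₁ v + (X (i + 1) - X i : MvPolynomial ℕ k) • c₂ v))
    (fun v w => by ext <;> simp; module)
    (fun a v => by ext <;> simp [CubicCrossing.C_smul]; module)
    (fun n v => by
      ext
      · simp [CubicCrossing.X_smul]
      · simp [CubicCrossing.X_smul, snd_X]; module)
  obtain ⟨σ, hσ⟩ := exists_linearMap (k := k) (M := CubicCrossing i B) (N₁ := B)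
    (fun v => c₀ v) (fun v w => by simp) (fun a v => by simp [CubicCrossing.C_smul])
    (fun n v => by simp [CubicCrossing.X_smul])
  refine ⟨ι, π, j, p, σ, ?_, ?_, ?_, ?_, ?_, ?_, ?_, ?_, ?_⟩
  · intro a b h
    rw [hι, hι] at h
    exact congrArg snd h
  · intro v
    rw [LinearMap.lsmul_apply, hζ]
    constructor
    · intro h
      have h' : fst v + (X (i + 1) - X i : MvPolynomial ℕ k) • snd v = 0 := congrArg snd h
      refine ⟨snd v, ?_⟩
      rw [hι]
      ext
      · rw [fst_mk, eq_neg_of_add_eq_zero_left h', ← neg_smul, neg_sub]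
      · simp
    · rintro ⟨b, rfl⟩
      rw [hι]
      ext
      · simp
      · simp; module
  · intro v
    rw [hπ]
    constructor
    · intro h
      refine ⟨mk (snd v) 0, ?_⟩
      rw [LinearMap.lsmul_apply, hζ]
      ext
      · simp [h]
      · simp
    · rintro ⟨w, rfl⟩
      rw [LinearMap.lsmul_apply, hζ, fst_mk]
  · exact fun b => ⟨mk b 0, by rw [hπ, fst_mk]⟩
  · intro v w h
    rw [hj, hj] at h
    exact Crossing.ext (congrArg c₁ h) (congrArg c₂ h)
  · intro v
    rw [hσ]
    constructor
    · intro h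
      refine ⟨mk (c₁ v) (c₂ v), ?_⟩
      rw [hj]
      exact CubicCrossing.ext h.symm rfl rfl
    · rintro ⟨w, rfl⟩
      rw [hj, CubicCrossing.c₀_mk]
  · exact fun b => ⟨CubicCrossing.mk b 0 0, by rw [hσ, CubicCrossing.c₀_mk]⟩
  · ext1 v
    rw [LinearMap.comp_apply, LinearMap.lsmul_apply, hj, hp, hζ]
    simp
  · ext1 v
    rw [LinearMap.comp_apply, hπ, hp, hσ, fst_mk]

/-- Far from the letters of `J`, a variable acts on `crossings J (BaseModule x)` as a scalar. -/
theorem X_smul_crossings {r : ℕ} (x : ℕ → k) {J : List ℕ} (hJ : ∀ a ∈ J, a + 1 < r)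
    (v : crossings J (ModuleCat.of (MvPolynomial ℕ k) (BaseModule x))) :
    (C (x r) - X r : MvPolynomial ℕ k) • v = 0 := by
  have h := crossingsMap_lsmul (x r) hJ (ModuleCat.of (MvPolynomial ℕ k) (BaseModule x))
  have h' : LinearMap.lsmul (MvPolynomial ℕ k) (ModuleCat.of (MvPolynomial ℕ k) (BaseModule x))
      (C (x r) - X r : MvPolynomial ℕ k) = 0 := by
    refine LinearMap.ext fun v => ?_
    refine (congrArg (· * (show k from v)) ?_ :
      eval₂Hom (RingHom.id k) x (C (x r) - X r) * (show k from v) = 0 * (show k from v)).trans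
      (zero_mul _)
    simp
  have h₀ : ∀ (J : List ℕ) (M : ModuleCat.{0} (MvPolynomial ℕ k)),
      crossingsMap J (0 : M →ₗ[MvPolynomial ℕ k] M) = 0 := by
    intro J
    induction J with
    | nil => exact fun _ => rfl
    | cons i J ih => exact fun M => ih (ModuleCat.of (MvPolynomial ℕ k) (Crossing i M))
  rw [h', h₀] at h
  exact (LinearMap.congr_fun h v).symm

/-- The regular sequence `x_j - y_j`. -/
def koszulSeq (x : ℕ → k) (r : ℕ) (j : Fin r) : MvPolynomial ℕ k := C (x j) - X (j : ℕ)

theorem braidClosed_projectiveKoszul (x : ℕ → k) (r : ℕ)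
    (M : ModuleCat.{0} (MvPolynomial ℕ k)) :
    BraidClosed fun J => ProjectiveKoszul C (koszulSeq x r) (crossings J M) where
  comm U V i j hij h := by
    rw [crossings_append] at h ⊢
    have key := isSummandOf_crossing_comm k (crossings U M) hij
    exact ProjectiveKoszul.of_isSummandOf h h (IsSummandOf.crossings V
      (M := crossings [j, i] (crossings U M)) (N₁ := crossings [i, j] (crossings U M))
      (N₂ := crossings [i, j] (crossings U M)) key)
  dup U V i h := by
    rw [crossings_append] at h ⊢
    have key := isSummandOf_crossing_crossing k (crossings U M) i
    exact ProjectiveKoszul.of_isSummandOf h h (IsSummandOf.crossings V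
      (M := crossings [i, i] (crossings U M)) (N₁ := crossings [i] (crossings U M))
      (N₂ := crossings [i] (crossings U M)) key)
  braid U V i h h' := by
    rw [crossings_append] at h h' ⊢
    have key := isSummandOf_braid k (crossings U M) (j := i) rfl
    exact ProjectiveKoszul.of_isSummandOf h h' (IsSummandOf.crossings V
      (M := crossings [i + 1, i, i + 1] (crossings U M))
      (N₁ := crossings [i, i + 1, i] (crossings U M))
      (N₂ := crossings [i + 1] (crossings U M)) key)

theorem projectiveOver_baseModule (x : ℕ → k) :
    ProjectiveOver (C : k →+* MvPolynomial ℕ k) (BaseModule x) := by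
  let _ : Module k (BaseModule x) := Module.compHom _ (C : k →+* MvPolynomial ℕ k)
  let e : k ≃ₗ[k] BaseModule x :=
    { AddEquiv.refl k with
      map_smul' := fun a b => by
        change (a * b : k) = (eval₂Hom (RingHom.id k) x (C a) * b : k)
        simp }
  exact Module.Projective.of_equiv e

theorem projectiveKoszul_crossings (x : ℕ → k) (r : ℕ) : ∀ J : List ℕ, (∀ a ∈ J, a + 1 < r) →
    ProjectiveKoszul C (koszulSeq x r)
      (crossings J (ModuleCat.of (MvPolynomial ℕ k) (BaseModule x))) := by
  induction r with
  | zero =>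
    intro J hJ
    cases J with
    | cons a J => exact absurd (hJ a (by simp)) (by simp)
    | nil =>
      have hd : ∀ v, koszulEnd (koszulSeq x 0) (BaseModule x) v = 0 := fun v => by
        funext t; simp [koszulEnd_apply, Subsingleton.elim tᶜ ∅]
      refine (projectiveOver_baseModule x).of_retract
        (Submodule.liftQ _ (LinearMap.proj ∅ ∘ₗ Submodule.subtype _) ?_)
        (Submodule.mkQ _ ∘ₗ LinearMap.codRestrict _ (LinearMap.pi fun _ => LinearMap.id)
          fun c => hd _) ?_
      · rintro ⟨v, hv⟩ ⟨w, hw⟩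
        have : v = 0 := hw.symm.trans (hd w)
        subst this
        rfl
      · intro y
        obtain ⟨v, hv, rfl⟩ := Homology.exists_cls y
        change Homology.cls _ (fun _ => v ∅) _ = _
        congr 1
        funext t
        rw [Subsingleton.elim t ∅]
  | succ r ih =>
    suffices h : ∀ J : List ℕ, (∀ a ∈ J, a < r) → J.count (r - 1) ≤ 1 →
        ProjectiveKoszul C (koszulSeq x (r + 1))
          (crossings J (ModuleCat.of (MvPolynomial ℕ k) (BaseModule x))) from
      fun J hJ => BraidClosed.of_count_le_one r (braidClosed_projectiveKoszul x (r + 1) _) h J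
        fun a ha => by have := hJ a ha; omega
    intro J hJ hcount
    by_cases hmem : r - 1 ∈ J
    · obtain ⟨U, V, rfl, hU⟩ := List.eq_append_cons_of_mem hmem
      have hV : r - 1 ∉ V := by
        rw [List.count_append, List.count_cons_self] at hcount
        exact List.count_eq_zero.1 (by omega)
      have hr : r - 1 + 1 = r := by
        have := hJ _ hmem
        omega
      have hU' : ∀ a ∈ U, a + 1 < r := fun a ha => by
        have := hJ a (by simp [ha])
        have : a ≠ r - 1 := fun e => hU (e ▸ ha)
        omega
      have hV' : ∀ a ∈ V, a + 1 < r := fun a ha => by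
        have := hJ a (by simp [ha])
        have : a ≠ r - 1 := fun e => hV (e ▸ ha)
        omega
      let B := crossings U (ModuleCat.of (MvPolynomial ℕ k) (BaseModule x))
      obtain ⟨ι, π, j, p, σ, hι, hιζ, hζπ, hπ, hj, hjσ, hσ, hpj, hπp⟩ :=
        exists_crossing_resolution hr (x r) B fun v => by
          have := X_smul_crossings x hU' v
          rw [sub_smul, sub_eq_zero] at this
          exact this.symm
      rw [crossings_append, crossings_cons]
      let M := ModuleCat.of (MvPolynomial ℕ k) (Crossing (r - 1) B)
      let N := ModuleCat.of (MvPolynomial ℕ k) (CubicCrossing (r - 1) B)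
      have hζ := crossingsMap_lsmul (x r) hV' M
      refine ProjectiveKoszul.succ (crossingsMap V (M := B) (N := M) ι)
        (crossingsMap V (M := M) (N := B) π) (crossingsMap V (M := M) (N := N) j)
        (crossingsMap V (M := N) (N := M) p) (crossingsMap V (M := N) (N := B) σ)
        (crossingsMap_injective V hι) ?_ ?_ (crossingsMap_surjective V hπ)
        (crossingsMap_injective V hj) (crossingsMap_exact V hjσ) (crossingsMap_surjective V hσ)
        ?_ ?_ ?_
      · have := crossingsMap_exact V (M := B) (N := M) (P := M) hιζ
        rwa [hζ] at this
      · have := crossingsMap_exact V (M := M) (N := M) (P := B) hζπ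
        rwa [hζ] at this
      · intro v
        refine (crossingsMap_comp V (M := M) (N := N) (P := M) j p v).trans ?_
        rw [hpj]
        exact LinearMap.congr_fun hζ v
      · intro v
        refine (crossingsMap_comp V (M := N) (N := M) (P := B) p π v).trans ?_
        rw [hπp]
      · have := ih (U ++ V) fun a ha => (List.mem_append.1 ha).elim (hU' a) (hV' a)
        rwa [crossings_append] at this
    · have hJ' : ∀ a ∈ J, a + 1 < r := fun a ha => by
        have := hJ a ha
        have : a ≠ r - 1 := fun e => hmem (e ▸ ha)
        omega
      have h0 : ∀ v : crossings J (ModuleCat.of (MvPolynomial ℕ k) (BaseModule x)),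
          koszulSeq x (r + 1) (Fin.last r) • v = 0 := X_smul_crossings x hJ'
      refine ProjectiveKoszul.succ LinearMap.id LinearMap.id
        (LinearMap.inl _ _ (crossings J (ModuleCat.of (MvPolynomial ℕ k) (BaseModule x))))
        (LinearMap.snd _ _ _) (LinearMap.snd _ _ _) Function.injective_id ?_ ?_
        Function.surjective_id LinearMap.inl_injective ?_ LinearMap.snd_surjective ?_
        (fun _ => rfl) (ih J hJ')
      · exact fun v => ⟨fun _ => ⟨v, rfl⟩, fun _ => h0 v⟩
      · exact fun v => ⟨fun h => ⟨0, (h0 0).trans h.symm⟩, fun ⟨w, hw⟩ => hw ▸ h0 w⟩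
      · exact Function.Exact.inl_snd
      · exact fun v => (h0 v).symm

end MainInduction

section GradedFree

variable {r : ℕ}

theorem MvPolynomial.exists_eq_C_constantCoeff_add (p : MvPolynomial (Fin r) ℤ) :
    ∃ q : Fin r → MvPolynomial (Fin r) ℤ, p = C (constantCoeff p) + ∑ j, X j * q j := by
  induction p using MvPolynomial.induction_on with
  | C a => exact ⟨0, by simp⟩
  | add p q hp hq =>
    obtain ⟨p', hp⟩ := hp
    obtain ⟨q', hq⟩ := hq
    refine ⟨p' + q', ?_⟩
    nth_rw 1 [hp, hq]
    simp only [Pi.add_apply, mul_add, Finset.sum_add_distrib, map_add]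
    abel
  | mul_X p i _ =>
    exact ⟨Pi.single i p, by simp [Pi.single_apply, mul_comm]⟩

/-- A finitely generated module `M` over a polynomial ring over `ℤ` is free as soon as there is a
linear map onto it from a finite free module with a section, inducing an isomorphism modulo the
variables. -/
theorem LinearMap.injective_of_section {d : ℕ} {M : Type} [AddCommGroup M]
    [Module (MvPolynomial (Fin r) ℤ) M]
    (φ : (Fin d → MvPolynomial (Fin r) ℤ) →ₗ[MvPolynomial (Fin r) ℤ] M)
    (s : M →ₗ[MvPolynomial (Fin r) ℤ] Fin d → MvPolynomial (Fin r) ℤ) (hs : ∀ m, φ (s m) = m)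
    (hφ : ∀ v, φ v = 0 → ∀ t, constantCoeff (v t) = 0) : Function.Injective φ := by
  set I : Ideal (MvPolynomial (Fin r) ℤ) := RingHom.ker constantCoeff with hI
  have hfg : (LinearMap.ker φ).FG := by
    have := isNoetherian_of_isNoetherianRing_of_finite (MvPolynomial (Fin r) ℤ)
      (Fin d → MvPolynomial (Fin r) ℤ)
    exact IsNoetherian.noetherian _
  obtain ⟨a, ha, hak⟩ := Submodule.exists_sub_one_mem_and_smul_eq_zero_of_fg_of_le_smul I
    (LinearMap.ker φ) hfg fun v hv => by
      choose q hq using fun t => (v t).exists_eq_C_constantCoeff_add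
      have hv' : v = ∑ j, (X j : MvPolynomial (Fin r) ℤ) • (fun t => q t j) := by
        funext t
        nth_rw 1 [hq t]
        simp [hφ v hv t]
      have hvs : v = ∑ j, (X j : MvPolynomial (Fin r) ℤ) •
          ((fun t => q t j) - s (φ fun t => q t j)) := by
        have : s (φ v) = 0 := by rw [LinearMap.mem_ker.1 hv, map_zero]
        rw [hv'] at this
        simp only [smul_sub, Finset.sum_sub_distrib]
        rw [← hv']
        simp only [map_sum, map_smul] at this
        rw [this, sub_zero]
      rw [hvs]
      exact Submodule.sum_mem _ fun j _ => Submodule.smul_mem_smul (by simp [hI])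
        (by simp [hs])
  have ha0 : a ≠ 0 := by
    rintro rfl
    simp [hI] at ha
  refine (injective_iff_map_eq_zero φ).2 fun v hv => ?_
  exact (smul_eq_zero.1 (hak v hv)).resolve_left ha0

/-- A finitely generated projective graded module over a polynomial ring over `ℤ` is free. The
grading is given by the projections `π n` to the homogeneous parts. -/
theorem Module.free_of_graded {M : Type} [AddCommGroup M] [Module (MvPolynomial (Fin r) ℤ) M]
    [Module.Finite (MvPolynomial (Fin r) ℤ) M] [Module.Projective (MvPolynomial (Fin r) ℤ) M]
    (π : ℕ → M →+ M) (hzero : ∀ j m, π 0 ((X j : MvPolynomial (Fin r) ℤ) • m) = 0)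
    (hsucc : ∀ n j m, π (n + 1) ((X j : MvPolynomial (Fin r) ℤ) • m) =
      (X j : MvPolynomial (Fin r) ℤ) • π n m)
    (hdiag : ∀ n m, π n (π n m) = π n m) (hoff : ∀ a b m, a ≠ b → π a (π b m) = 0)
    (hsum : ∀ m, ∃ N, ∀ N', N ≤ N' → ∑ n ∈ Finset.range N', π n m = m) :
    Module.Free (MvPolynomial (Fin r) ℤ) M := by
  obtain ⟨e, p, hp⟩ := Module.Finite.exists_fin' (MvPolynomial (Fin r) ℤ) M
  obtain ⟨i, hi⟩ := Module.projective_lifting_property p LinearMap.id hp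
  have hpi : ∀ m, p (i m) = m := LinearMap.congr_fun hi
  let Q : M →ₗ[ℤ] (Fin e → ℤ) :=
    ((AddMonoidHom.compLeft (constantCoeff : MvPolynomial (Fin r) ℤ →+* ℤ).toAddMonoidHom
      (Fin e)).comp i.toAddMonoidHom).toIntLinearMap
  have hQ : ∀ m t, Q m t = constantCoeff (i m t) := fun _ _ => rfl
  have hQsmul : ∀ (c : MvPolynomial (Fin r) ℤ) m, Q (c • m) = constantCoeff c • Q m := fun c m => by
    funext t
    simp [hQ]
  have hker : ∀ m, Q m = 0 → ∃ w : Fin r → M, m = ∑ j, (X j : MvPolynomial (Fin r) ℤ) • w j := by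
    intro m hm
    choose q hq using fun t => (i m t).exists_eq_C_constantCoeff_add
    refine ⟨fun j => p fun t => q t j, ?_⟩
    rw [← hpi m]
    simp only [← map_smul, ← map_sum]
    congr 1
    funext t
    nth_rw 1 [hq t]
    rw [← hQ, hm]
    simp
  have hQπ : ∀ n m, Q m = 0 → Q (π n m) = 0 := by
    intro n m hm
    obtain ⟨w, rfl⟩ := hker m hm
    rw [map_sum, map_sum]
    refine Finset.sum_eq_zero fun j _ => ?_
    cases n with
    | zero => rw [hzero, map_zero]
    | succ n => rw [hsucc, hQsmul]; simp
  obtain ⟨σ₀, hσ₀⟩ := Module.projective_lifting_property Q.rangeRestrict LinearMap.id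
    Q.surjective_rangeRestrict
  have hQσ₀ : ∀ v, Q (σ₀ v) = v := fun v => congrArg Subtype.val (LinearMap.congr_fun hσ₀ v)
  let b := Module.finBasis ℤ (LinearMap.range Q)
  choose N₀ hN₀ using fun t => hsum (σ₀ (b t))
  obtain ⟨N, hN⟩ : ∃ N, ∀ v, ∑ n ∈ Finset.range N, π n (σ₀ v) = σ₀ v := by
    refine ⟨Finset.univ.sup N₀, fun v => ?_⟩
    have := b.ext (f₁ := (∑ n ∈ Finset.range (Finset.univ.sup N₀),
      (π n).toIntLinearMap) ∘ₗ σ₀) (f₂ := σ₀) fun t => by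
        simpa using hN₀ t _ (Finset.le_sup (Finset.mem_univ t))
    simpa using LinearMap.congr_fun this v
  let σ : LinearMap.range Q →ₗ[ℤ] M := ∑ n ∈ Finset.range N,
    (π n).toIntLinearMap ∘ₗ σ₀ ∘ₗ Q.rangeRestrict ∘ₗ (π n).toIntLinearMap ∘ₗ σ₀
  have hσ : ∀ v, σ v = ∑ n ∈ Finset.range N,
    π n (σ₀ (Q.rangeRestrict (π n (σ₀ v)))) := fun v => by
    simp only [σ, LinearMap.sum_apply]; rfl
  have hQeq : ∀ n m m', Q m = Q m' → Q (π n m) = Q (π n m') := fun n m m' h => by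
    rw [← sub_eq_zero, ← map_sub, ← map_sub]
    exact hQπ n _ (by rw [map_sub, h, sub_self])
  have hQσ : ∀ v, Q (σ v) = v := by
    intro v
    have : ∀ n, Q (π n (σ₀ (Q.rangeRestrict (π n (σ₀ v))))) = Q (π n (σ₀ v)) := fun n => by
      rw [hQeq n _ (π n (σ₀ v)) (hQσ₀ _), hdiag]
    rw [hσ, map_sum, Finset.sum_congr rfl fun n _ => this n, ← map_sum, hN, hQσ₀]
  have hπσ : ∀ n m, π n (σ (Q.rangeRestrict (π n m))) = σ (Q.rangeRestrict (π n m)) := by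
    intro n m
    have : ∀ a, a ≠ n → Q.rangeRestrict (π a (σ₀ (Q.rangeRestrict (π n m)))) = 0 := by
      intro a ha
      refine Subtype.ext ((hQeq a _ (π n m) (hQσ₀ _)).trans ?_)
      rw [hoff a n m ha, map_zero]
      rfl
    rw [hσ, map_sum]
    refine Finset.sum_congr rfl fun a _ => ?_
    by_cases ha : a = n
    · rw [ha, hdiag]
    · rw [this a ha, map_zero, map_zero, map_zero]
  let φ := Fintype.linearCombination (MvPolynomial (Fin r) ℤ) fun t => σ (b t)
  have hφσ : ∀ v, σ v ∈ LinearMap.range φ := by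
    intro v
    rw [← b.sum_repr v, map_sum]
    refine Submodule.sum_mem _ fun t _ => ?_
    rw [map_zsmul]
    refine zsmul_mem (LinearMap.mem_range.2 ⟨Pi.single t 1, ?_⟩) _
    simp [φ, Fintype.linearCombination_apply_single]
  have hsurj : ∀ n m, π n m ∈ LinearMap.range φ := by
    intro n
    induction n with
    | zero =>
      intro m
      obtain ⟨w, hw⟩ := hker (π 0 m - σ (Q.rangeRestrict (π 0 m)))
        (by rw [map_sub, hQσ]; exact sub_self _)
      have h := congrArg (π 0) hw
      rw [map_sub, hπσ, hdiag, map_sum, Finset.sum_congr rfl fun j _ => hzero j (w j),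
        Finset.sum_const_zero, sub_eq_zero] at h
      rw [h]
      exact hφσ _
    | succ n ih =>
      intro m
      obtain ⟨w, hw⟩ := hker (π (n + 1) m - σ (Q.rangeRestrict (π (n + 1) m)))
        (by rw [map_sub, hQσ]; exact sub_self _)
      have h := congrArg (π (n + 1)) hw
      rw [map_sub, hπσ, hdiag, map_sum, Finset.sum_congr rfl fun j _ => hsucc n j (w j),
        sub_eq_iff_eq_add] at h
      rw [h]
      exact add_mem (sum_mem fun j _ => Submodule.smul_mem _ _ (ih _)) (hφσ _)
  have hφsurj : Function.Surjective φ := by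
    intro m
    obtain ⟨N, hN⟩ := hsum m
    rw [← LinearMap.mem_range, ← hN N le_rfl]
    exact sum_mem fun n _ => hsurj n m
  obtain ⟨s, hs⟩ := Module.projective_lifting_property φ LinearMap.id hφsurj
  have hinj := φ.injective_of_section s (LinearMap.congr_fun hs) fun v hv t => by
    have h : ∑ t, constantCoeff (v t) • b t = 0 := by
      refine Subtype.ext ?_
      rw [Submodule.coe_sum]
      have := congrArg Q hv
      rw [Fintype.linearCombination_apply, map_sum, map_zero] at this
      rw [← (show _ = (0 : LinearMap.range Q).1 from this)]
      refine Finset.sum_congr rfl fun t _ => ?_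
      rw [hQsmul, hQσ]
      rfl
    exact Fintype.linearIndependent_iff.1 b.linearIndependent _ h t
  exact Module.Free.of_equiv (LinearEquiv.ofBijective φ ⟨hinj, hφsurj⟩)

end GradedFree

section BottSamelsonStep

variable {m l : ℕ}

/-- The inclusion of polynomial rings adding one variable `δ`. -/
def polyIncl (m l : ℕ) : BSPoly m l →+* BSPoly m (l + 1) :=
  (rename (Sum.map id Fin.castSucc)).toRingHom

@[simp] theorem polyIncl_x (j : Fin (m + 2)) :
    polyIncl m l (X (Sum.inl j)) = X (Sum.inl j) := by simp [polyIncl]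

@[simp] theorem polyIncl_δ (t : Fin l) :
    polyIncl m l (X (Sum.inr t)) = X (Sum.inr t.castSucc) := by simp [polyIncl]

/-- The polynomial representing `y_c - y_{c+1}`. -/
def rootPoly (m l : ℕ) (i : Fin l → Fin (m + 1)) (c : Fin (m + 1)) : BSPoly m l :=
  X (Sum.inl c.castSucc) - X (Sum.inl c.succ)
    + 2 * ∑ s ∈ Finset.univ.filter fun s => i s = c, X (Sum.inr s)
    - ∑ s ∈ Finset.univ.filter
        fun s => (i s : ℕ) = (c : ℕ) + 1 ∨ (c : ℕ) = (i s : ℕ) + 1, X (Sum.inr s)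

theorem mk_rootPoly (i : Fin l → Fin (m + 1)) (c : Fin (m + 1)) :
    (Ideal.Quotient.mk _ (rootPoly m l i c) : BSRing m l i) =
      yB m l i c.castSucc - yB m l i c.succ := by
  have h₁ : δhat m l i ((c : ℕ) : ℤ) = ∑ s ∈ Finset.univ.filter fun s => i s = c, δB m l i s := by
    refine Finset.sum_congr (Finset.filter_congr fun s _ => ?_) fun _ _ => rfl
    rw [Nat.cast_inj, Fin.val_inj]
  have h₂ : δhat m l i ((c : ℕ) + 1 : ℤ) + δhat m l i ((c : ℕ) - 1 : ℤ) =
      ∑ s ∈ Finset.univ.filter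
        fun s => (i s : ℕ) = (c : ℕ) + 1 ∨ (c : ℕ) = (i s : ℕ) + 1, δB m l i s := by
    rw [δhat, δhat, ← Finset.sum_union]
    · refine Finset.sum_congr ?_ fun _ _ => rfl
      ext s
      simp only [Finset.mem_union, Finset.mem_filter, Finset.mem_univ, true_and]
      omega
    · refine Finset.disjoint_filter.2 fun s _ h h' => ?_
      omega
  rw [rootPoly, map_sub, map_add, map_sub, map_mul, map_sum, map_sum, map_ofNat]
  change xB m l i _ - xB m l i _ + 2 * (∑ s ∈ _, δB m l i s) - (∑ s ∈ _, δB m l i s) = _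
  rw [← h₁, ← h₂]
  simp only [yB, Fin.val_succ, Fin.val_castSucc, Nat.cast_add, Nat.cast_one, add_sub_cancel_right]
  ring

theorem BSrel_last (i : Fin (l + 1) → Fin (m + 1)) :
    BSrel m (l + 1) i (Fin.last l) = X (Sum.inr (Fin.last l)) * (X (Sum.inr (Fin.last l)) +
      polyIncl m l (rootPoly m l (i ∘ Fin.castSucc) (i (Fin.last l)))) := by
  have hsum : ∀ (P : Fin (l + 1) → Prop) [DecidablePred P],
      ∑ s ∈ Finset.univ.filter (fun s => s < Fin.last l ∧ P s), X (Sum.inr s) =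
        polyIncl m l (∑ s ∈ Finset.univ.filter (fun s => P (Fin.castSucc s)), X (Sum.inr s)) := by
    intro P _
    rw [Finset.sum_filter, Fin.sum_univ_castSucc, Finset.sum_filter, map_sum]
    simp [Fin.castSucc_lt_last, apply_ite (polyIncl m l)]
  rw [BSrel, hsum, hsum, rootPoly]
  simp only [map_sub, map_add, map_mul, map_ofNat, polyIncl_x, Function.comp_apply]
  ring

theorem BSrel_castSucc (i : Fin (l + 1) → Fin (m + 1)) (t : Fin l) :
    BSrel m (l + 1) i t.castSucc = polyIncl m l (BSrel m l (i ∘ Fin.castSucc) t) := by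
  have hsum : ∀ (P : Fin (l + 1) → Prop) [DecidablePred P],
      ∑ s ∈ Finset.univ.filter (fun s => s < t.castSucc ∧ P s), X (Sum.inr s) =
        polyIncl m l (∑ s ∈ Finset.univ.filter (fun s => s < t ∧ P (Fin.castSucc s)),
          X (Sum.inr s)) := by
    intro P _
    rw [Finset.sum_filter, Fin.sum_univ_castSucc, Finset.sum_filter, map_sum]
    simp [Fin.not_lt.2 (Fin.le_last _), apply_ite (polyIncl m l)]
  rw [BSrel, hsum, hsum, BSrel]
  simp only [map_sub, map_add, map_mul, map_ofNat, polyIncl_x, polyIncl_δ, Function.comp_apply]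

/-- The map of Bott–Samelson rings induced by appending a letter to a word. -/
def bsIncl (m l : ℕ) (i : Fin (l + 1) → Fin (m + 1)) :
    BSRing m l (i ∘ Fin.castSucc) →+* BSRing m (l + 1) i :=
  Ideal.quotientMap _ (polyIncl m l) (by
    rw [Ideal.span_le]
    rintro _ ⟨t, rfl⟩
    exact Ideal.subset_span ⟨t.castSucc, BSrel_castSucc i t⟩)

theorem bsIncl_mk (i : Fin (l + 1) → Fin (m + 1)) (p : BSPoly m l) :
    bsIncl m l i (Ideal.Quotient.mk _ p) = Ideal.Quotient.mk _ (polyIncl m l p) := rfl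

@[simp] theorem bsIncl_xB (i : Fin (l + 1) → Fin (m + 1)) (j : Fin (m + 2)) :
    bsIncl m l i (xB m l _ j) = xB m (l + 1) i j := by
  rw [xB, bsIncl_mk, polyIncl_x, xB]

@[simp] theorem bsIncl_δB (i : Fin (l + 1) → Fin (m + 1)) (t : Fin l) :
    bsIncl m l i (δB m l _ t) = δB m (l + 1) i t.castSucc := by
  rw [δB, bsIncl_mk, polyIncl_δ, δB]

theorem δhat_succ (i : Fin (l + 1) → Fin (m + 1)) (c : ℤ) :
    δhat m (l + 1) i c = bsIncl m l i (δhat m l (i ∘ Fin.castSucc) c) +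
      if ((i (Fin.last l) : ℕ) : ℤ) = c then δB m (l + 1) i (Fin.last l) else 0 := by
  rw [δhat, Finset.sum_filter, Fin.sum_univ_castSucc, δhat, Finset.sum_filter, map_sum]
  simp [apply_ite (bsIncl m l i)]

theorem yB_succ (i : Fin (l + 1) → Fin (m + 1)) (j : Fin (m + 2)) :
    yB m (l + 1) i j = bsIncl m l i (yB m l (i ∘ Fin.castSucc) j) +
      crossingSign (i (Fin.last l)) j * δB m (l + 1) i (Fin.last l) := by
  have : ((crossingSign (i (Fin.last l)) j : ℤ) : BSRing m (l + 1) i) =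
      (if ((i (Fin.last l) : ℕ) : ℤ) = (j : ℕ) then 1 else 0) -
        (if ((i (Fin.last l) : ℕ) : ℤ) = (j : ℕ) - 1 then 1 else 0) := by
    unfold crossingSign
    split_ifs <;> first | omega | simp
  rw [this, yB, δhat_succ, δhat_succ, yB, map_sub, map_add, bsIncl_xB]
  simp only [sub_mul, ite_mul, one_mul, zero_mul]
  ring

theorem δB_last_mul (i : Fin (l + 1) → Fin (m + 1)) :
    δB m (l + 1) i (Fin.last l) * δB m (l + 1) i (Fin.last l) =
      bsIncl m l i (yB m l (i ∘ Fin.castSucc) (i (Fin.last l)).succ -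
        yB m l (i ∘ Fin.castSucc) (i (Fin.last l)).castSucc) * δB m (l + 1) i (Fin.last l) := by
  have h : (Ideal.Quotient.mk _ (BSrel m (l + 1) i (Fin.last l)) : BSRing m (l + 1) i) = 0 :=
    Ideal.Quotient.eq_zero_iff_mem.2 (Ideal.subset_span ⟨_, rfl⟩)
  rw [BSrel_last, map_mul, map_add, ← bsIncl_mk, mk_rootPoly] at h
  change δB m (l + 1) i (Fin.last l) * (δB m (l + 1) i (Fin.last l) + _) = 0 at h
  rw [map_sub] at h ⊢
  linear_combination h

/-- The quadratic extension of Bott–Samelson rings obtained by appending a letter. -/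
abbrev BSQuadratic (m l : ℕ) (i : Fin (l + 1) → Fin (m + 1)) : Type :=
  QuadraticAlgebra (BSRing m l (i ∘ Fin.castSucc)) 0
    (yB m l (i ∘ Fin.castSucc) (i (Fin.last l)).succ -
      yB m l (i ∘ Fin.castSucc) (i (Fin.last l)).castSucc)

/-- The images of the variables in the quadratic extension. -/
def quadraticEval (m l : ℕ) (i : Fin (l + 1) → Fin (m + 1)) :
    BSPoly m (l + 1) →+* BSQuadratic m l i :=
  (aeval (Sum.elim (fun j => algebraMap (BSRing m l (i ∘ Fin.castSucc)) _ (xB m l _ j))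
    (Fin.lastCases (motive := fun _ => BSQuadratic m l i) ⟨0, 1⟩ fun t =>
      algebraMap (BSRing m l (i ∘ Fin.castSucc)) _ (δB m l _ t)))).toRingHom

theorem quadraticEval_polyIncl (i : Fin (l + 1) → Fin (m + 1)) (p : BSPoly m l) :
    quadraticEval m l i (polyIncl m l p) =
      algebraMap (BSRing m l (i ∘ Fin.castSucc)) _ (Ideal.Quotient.mk _ p) := by
  refine RingHom.congr_fun (f := (quadraticEval m l i).comp (polyIncl m l))
    (g := (algebraMap (BSRing m l (i ∘ Fin.castSucc)) _).comp (Ideal.Quotient.mk _))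
    (MvPolynomial.ringHom_ext (fun n => by simp) fun v => ?_) p
  cases v with
  | inl j => simp [quadraticEval]; rfl
  | inr t => simp [quadraticEval]; rfl

theorem quadraticEval_last (i : Fin (l + 1) → Fin (m + 1)) :
    quadraticEval m l i (X (Sum.inr (Fin.last l))) = ⟨0, 1⟩ := by
  simp [quadraticEval]

/-- The map from the Bott–Samelson ring to the quadratic extension. -/
def toQuadratic (m l : ℕ) (i : Fin (l + 1) → Fin (m + 1)) :
    BSRing m (l + 1) i →+* BSQuadratic m l i :=
  Ideal.Quotient.lift _ (quadraticEval m l i) (by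
    suffices h : Ideal.span (Set.range (BSrel m (l + 1) i)) ≤ RingHom.ker (quadraticEval m l i) from
      fun a ha => h ha
    rw [Ideal.span_le]
    rintro _ ⟨t, rfl⟩
    rw [SetLike.mem_coe, RingHom.mem_ker]
    induction t using Fin.lastCases with
    | cast t =>
      rw [BSrel_castSucc, quadraticEval_polyIncl,
        Ideal.Quotient.eq_zero_iff_mem.2 (Ideal.subset_span (Set.mem_range_self t)), map_zero]
    | last =>
      rw [BSrel_last, map_mul, map_add, quadraticEval_polyIncl, mk_rootPoly, quadraticEval_last]
      ext <;> simp)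

theorem toQuadratic_bsIncl (i : Fin (l + 1) → Fin (m + 1)) (a : BSRing m l (i ∘ Fin.castSucc)) :
    toQuadratic m l i (bsIncl m l i a) = algebraMap _ _ a := by
  obtain ⟨p, rfl⟩ := Ideal.Quotient.mk_surjective a
  exact quadraticEval_polyIncl i p

theorem toQuadratic_δB_last (i : Fin (l + 1) → Fin (m + 1)) :
    toQuadratic m l i (δB m (l + 1) i (Fin.last l)) = ⟨0, 1⟩ := quadraticEval_last i

theorem toQuadratic_incl_add (i : Fin (l + 1) → Fin (m + 1))
    (a b : BSRing m l (i ∘ Fin.castSucc)) :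
    toQuadratic m l i (bsIncl m l i a + bsIncl m l i b * δB m (l + 1) i (Fin.last l)) =
      ⟨a, b⟩ := by
  rw [map_add, map_mul, toQuadratic_bsIncl, toQuadratic_bsIncl, toQuadratic_δB_last]
  ext <;> simp

theorem exists_eq_bsIncl_add (i : Fin (l + 1) → Fin (m + 1)) (v : BSRing m (l + 1) i) :
    ∃ a b, v = bsIncl m l i a + bsIncl m l i b * δB m (l + 1) i (Fin.last l) := by
  obtain ⟨p, rfl⟩ := Ideal.Quotient.mk_surjective v
  induction p using MvPolynomial.induction_on with
  | C n => exact ⟨n, 0, by simp⟩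
  | add p q hp hq =>
    obtain ⟨a, b, h⟩ := hp
    obtain ⟨a', b', h'⟩ := hq
    exact ⟨a + a', b + b', by simp only [map_add, h, h']; ring⟩
  | mul_X p v hp =>
    obtain ⟨a, b, h⟩ := hp
    rw [map_mul, h]
    rcases v with j | t
    · refine ⟨a * xB m l _ j, b * xB m l _ j, ?_⟩
      change _ * xB m (l + 1) i j = _
      rw [map_mul, map_mul, bsIncl_xB]
      ring
    · change ∃ a' b', _ * δB m (l + 1) i t = _
      induction t using Fin.lastCases with
      | cast t =>
        refine ⟨a * δB m l _ t, b * δB m l _ t, ?_⟩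
        rw [map_mul, map_mul, bsIncl_δB]
        ring
      | last =>
        refine ⟨0, a + b * (yB m l (i ∘ Fin.castSucc) (i (Fin.last l)).succ -
          yB m l (i ∘ Fin.castSucc) (i (Fin.last l)).castSucc), ?_⟩
        rw [map_zero, map_add, map_mul, add_mul, mul_assoc, δB_last_mul]
        ring

theorem toQuadratic_bijective (i : Fin (l + 1) → Fin (m + 1)) :
    Function.Bijective (toQuadratic m l i) := by
  refine ⟨(injective_iff_map_eq_zero _).2 fun v hv => ?_, fun v =>
    ⟨_, toQuadratic_incl_add i v.re v.im⟩⟩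
  obtain ⟨a, b, rfl⟩ := exists_eq_bsIncl_add i v
  rw [toQuadratic_incl_add] at hv
  have ha : a = 0 := congrArg QuadraticAlgebra.re hv
  have hb : b = 0 := congrArg QuadraticAlgebra.im hv
  rw [ha, hb, map_zero, zero_mul, add_zero]

end BottSamelsonStep

section BottSamelsonCrossings

variable {m l : ℕ}

theorem ψBS_X (i : Fin l → Fin (m + 1)) (j : Fin (m + 2)) : ψBS m l i (X j) = xB m l i j := by
  simp [ψBS]

theorem ψBS_succ (i : Fin (l + 1) → Fin (m + 1)) (c : MvPolynomial (Fin (m + 2)) ℤ) :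
    ψBS m (l + 1) i c = bsIncl m l i (ψBS m l (i ∘ Fin.castSucc) c) := by
  refine RingHom.congr_fun (f := ψBS m (l + 1) i) (g := (bsIncl m l i).comp (ψBS m l _))
    (MvPolynomial.ringHom_ext (fun n => by simp [ψBS]) fun j => ?_) c
  rw [RingHom.comp_apply, ψBS_X, ψBS_X, bsIncl_xB]

/-- The variables `x_1,…,x_r`, extended by zero. -/
def xSeq (m n : ℕ) : MvPolynomial (Fin (m + 2)) ℤ := if h : n < m + 2 then X ⟨n, h⟩ else 0

theorem xSeq_fin (j : Fin (m + 2)) : xSeq m j = X j := by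
  rw [xSeq, dif_pos j.2]

theorem ψBS_zero_bijective (i : Fin 0 → Fin (m + 1)) : Function.Bijective (ψBS m 0 i) := by
  have hI : Ideal.span (Set.range (BSrel m 0 i)) = ⊥ := by
    rw [Set.range_eq_empty, Ideal.span_empty]
  have h : ∀ c, ψBS m 0 i c = Ideal.Quotient.mk _ (rename Sum.inl c) := by
    refine RingHom.congr_fun (f := ψBS m 0 i) (g := (Ideal.Quotient.mk _).comp
      (rename Sum.inl : _ →ₐ[ℤ] BSPoly m 0).toRingHom)
      (MvPolynomial.ringHom_ext (fun n => by simp [ψBS]) fun j => ?_)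
    rw [ψBS_X, RingHom.comp_apply]
    simp [xB]
  constructor
  · refine (injective_iff_map_eq_zero _).2 fun c hc => ?_
    rw [h, Ideal.Quotient.eq_zero_iff_mem, hI, Ideal.mem_bot] at hc
    exact rename_injective _ Sum.inl_injective (hc.trans (map_zero _).symm)
  · intro v
    obtain ⟨p, rfl⟩ := Ideal.Quotient.mk_surjective v
    induction p using MvPolynomial.induction_on with
    | C n => exact ⟨C n, by rw [h, rename_C]⟩
    | add p q hp hq =>
      obtain ⟨a, ha⟩ := hp
      obtain ⟨b, hb⟩ := hq
      exact ⟨a + b, by rw [map_add, map_add, ha, hb]⟩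
    | mul_X p v hp =>
      obtain ⟨a, ha⟩ := hp
      rcases v with j | t
      · exact ⟨a * X j, by rw [map_mul, map_mul, ha, ψBS_X, xB]⟩
      · exact t.elim0

/-- `R_J` with the letter `i_{l+1}` appended is the crossing of `R_J`. -/
theorem exists_addEquiv_crossing {N : Type} [AddCommGroup N]
    [Module (MvPolynomial ℕ (MvPolynomial (Fin (m + 2)) ℤ)) N] (i : Fin (l + 1) → Fin (m + 1))
    (θ : BSRing m l (i ∘ Fin.castSucc) ≃+ N)
    (hC : ∀ c v, θ (ψBS m l _ c * v) =
      (C c : MvPolynomial ℕ (MvPolynomial (Fin (m + 2)) ℤ)) • θ v)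
    (hX : ∀ (j : Fin (m + 2)) v, θ (yB m l _ j * v) =
      (X (j : ℕ) : MvPolynomial ℕ (MvPolynomial (Fin (m + 2)) ℤ)) • θ v) :
    ∃ θ' : BSRing m (l + 1) i ≃+ Crossing (i (Fin.last l)) N,
      (∀ c v, θ' (ψBS m (l + 1) i c * v) =
        (C c : MvPolynomial ℕ (MvPolynomial (Fin (m + 2)) ℤ)) • θ' v) ∧
      ∀ (j : Fin (m + 2)) v, θ' (yB m (l + 1) i j * v) =
        (X (j : ℕ) : MvPolynomial ℕ (MvPolynomial (Fin (m + 2)) ℤ)) • θ' v := by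
  let e := AddEquiv.ofBijective (toQuadratic m l i).toAddMonoidHom (toQuadratic_bijective i)
  let f : BSQuadratic m l i ≃+ Crossing (i (Fin.last l)) N :=
    { toFun := fun v => Crossing.mk (θ v.re) (θ v.im)
      invFun := fun w => ⟨θ.symm (Crossing.fst w), θ.symm (Crossing.snd w)⟩
      left_inv := fun v => by ext <;> simp
      right_inv := fun w => by ext <;> simp
      map_add' := fun v w => by
        ext
        · exact map_add θ v.re w.re
        · exact map_add θ v.im w.im }
  refine ⟨e.trans f, fun c v => ?_, fun j v => ?_⟩
  · have h : e (ψBS m (l + 1) i c * v) =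
        algebraMap (BSRing m l (i ∘ Fin.castSucc)) _ (ψBS m l _ c) * toQuadratic m l i v := by
      change toQuadratic m l i _ = _
      rw [map_mul, ψBS_succ, toQuadratic_bsIncl]
    change f (e _) = C c • f (toQuadratic m l i v)
    rw [h, ← Algebra.smul_def]
    apply Crossing.ext
    · rw [Crossing.fst_C]; exact hC c _
    · rw [Crossing.snd_C]; exact hC c _
  · have h : e (yB m (l + 1) i j * v) =
        (algebraMap (BSRing m l (i ∘ Fin.castSucc)) _ (yB m l _ j) +
          crossingSign (i (Fin.last l)) j * ⟨0, 1⟩) * toQuadratic m l i v := by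
      change toQuadratic m l i _ = _
      rw [map_mul, yB_succ, map_add, map_mul, toQuadratic_bsIncl, toQuadratic_δB_last,
        map_intCast]
    change f (e _) = X (j : ℕ) • f (toQuadratic m l i v)
    rw [h]
    obtain ⟨a, b⟩ := toQuadratic m l i v
    apply Crossing.ext
    · rw [Crossing.fst_X]
      change θ _ = _ • θ a
      rw [← hX]
      congr 1
      simp
    · rw [Crossing.snd_X]
      change θ _ = _ • θ b + _ • (θ a + (X (((i (Fin.last l)).succ : Fin (m + 2)) : ℕ) -
        X (((i (Fin.last l)).castSucc : Fin (m + 2)) : ℕ) :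
          MvPolynomial ℕ (MvPolynomial (Fin (m + 2)) ℤ)) • θ b)
      rw [sub_smul, ← hX, ← hX, ← hX, ← map_sub, ← map_add, ← map_zsmul, ← map_add]
      congr 1
      simp
      ring

theorem exists_addEquiv_crossings : ∀ (l : ℕ) (i : Fin l → Fin (m + 1)),
    ∃ θ : BSRing m l i ≃+ crossings (List.ofFn fun t => (i t : ℕ))
        (ModuleCat.of (MvPolynomial ℕ (MvPolynomial (Fin (m + 2)) ℤ)) (BaseModule (xSeq m))),
      (∀ c v, θ (ψBS m l i c * v) =
        (C c : MvPolynomial ℕ (MvPolynomial (Fin (m + 2)) ℤ)) • θ v) ∧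
      ∀ (j : Fin (m + 2)) v, θ (yB m l i j * v) =
        (X (j : ℕ) : MvPolynomial ℕ (MvPolynomial (Fin (m + 2)) ℤ)) • θ v := by
  intro l
  induction l with
  | zero =>
    intro i
    let e : BSRing m 0 i ≃+* MvPolynomial (Fin (m + 2)) ℤ :=
      (RingEquiv.ofBijective _ (ψBS_zero_bijective i)).symm
    have he : ∀ c, e (ψBS m 0 i c) = c := fun c =>
      (RingEquiv.ofBijective _ (ψBS_zero_bijective i)).symm_apply_apply c
    rw [List.ofFn_zero]
    refine ⟨e.toAddEquiv, fun c v => ?_, fun j v => ?_⟩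
    · change e (ψBS m 0 i c * v) = eval₂Hom (RingHom.id _) (xSeq m) (C c) * e v
      rw [map_mul, he, eval₂Hom_C, RingHom.id_apply]
    · change e (yB m 0 i j * v) = eval₂Hom (RingHom.id _) (xSeq m) (X (j : ℕ)) * e v
      have : yB m 0 i j = ψBS m 0 i (X j) := by
        rw [ψBS_X, yB, δhat, δhat]
        simp
      rw [map_mul, this, he, eval₂Hom_X', xSeq_fin]
  | succ l ih =>
    intro i
    obtain ⟨θ, hC, hX⟩ := ih (i ∘ Fin.castSucc)
    rw [List.ofFn_succ', List.concat_eq_append, crossings_append, crossings_cons]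
    exact exists_addEquiv_crossing i θ hC hX

theorem ψBS_finite : ∀ (l : ℕ) (i : Fin l → Fin (m + 1)), (ψBS m l i).Finite := by
  intro l
  induction l with
  | zero => exact fun i => RingHom.Finite.of_surjective _ (ψBS_zero_bijective i).2
  | succ l ih =>
    intro i
    let e := RingEquiv.ofBijective _ (toQuadratic_bijective i)
    have h : ψBS m (l + 1) i = e.symm.toRingHom.comp
        ((algebraMap (BSRing m l (i ∘ Fin.castSucc)) (BSQuadratic m l i)).comp (ψBS m l _)) := by
      refine RingHom.ext fun c => (e.symm_apply_eq.2 ?_).symm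
      change _ = toQuadratic m l i (ψBS m (l + 1) i c)
      rw [ψBS_succ, toQuadratic_bsIncl, RingHom.comp_apply]
    rw [h]
    refine RingHom.Finite.comp (RingHom.Finite.of_surjective _ e.symm.surjective)
      (RingHom.Finite.comp ?_ (ih _))
    exact RingHom.finite_algebraMap.2 inferInstance

end BottSamelsonCrossings

/-- The map of quotients induced by an additive map of modules over possibly different rings. -/
def Submodule.quotientAddMap {R R' M N : Type} [Ring R] [Ring R'] [AddCommGroup M] [Module R M]
    [AddCommGroup N] [Module R' N] (p : Submodule R M) (q : Submodule R' N) (f : M →+ N)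
    (h : ∀ v ∈ p, f v ∈ q) : M ⧸ p →+ N ⧸ q :=
  QuotientAddGroup.map p.toAddSubgroup q.toAddSubgroup f h

theorem ProjectiveOver.of_addMonoidHom {k R R' M N : Type} [CommRing k] [CommRing R]
    [CommRing R'] {φ : k →+* R} {φ' : k →+* R'} [AddCommGroup M] [Module R M] [AddCommGroup N]
    [Module R' N] (h : ProjectiveOver φ' N) (f : M →+ N) (g : N →+ M)
    (hf : ∀ c v, f (φ c • v) = φ' c • f v) (hg : ∀ c v, g (φ' c • v) = φ c • g v)
    (hgf : ∀ v, g (f v) = v) : ProjectiveOver φ M := by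
  let _ : Module k M := Module.compHom M φ
  let _ : Module k N := Module.compHom N φ'
  let f' : M →ₗ[k] N := { f with map_smul' := hf }
  let g' : N →ₗ[k] M := { g with map_smul' := hg }
  have : Module.Projective k N := h
  exact Module.Projective.of_split f' g' (LinearMap.ext hgf)

section KoszulDegree

variable {B N E k : Type} [CommRing B] [CommRing E] [AddCommGroup N] [Module E N] [CommRing k]
  {r : ℕ}

/-- The projection of the Koszul complex to exterior degree `q`. -/
def koszulProj (M : Type) [AddCommGroup M] (r : ℕ) (q : ℤ) :
    (Finset (Fin r) → M) →+ (Finset (Fin r) → M) where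
  toFun v t := if (t.card : ℤ) = q then v t else 0
  map_zero' := by ext; simp
  map_add' v w := by ext t; simp only [Pi.add_apply]; split_ifs <;> simp

theorem koszulProj_apply {M : Type} [AddCommGroup M] (q : ℤ) (v : Finset (Fin r) → M)
    (t : Finset (Fin r)) : koszulProj M r q v t = if (t.card : ℤ) = q then v t else 0 := rfl

theorem koszulProj_mem_kdeg (q : ℤ) (v : Finset (Fin r) → B) : koszulProj B r q v ∈ kdeg B r q :=
  fun _ hs => if_neg hs

theorem koszulProj_of_mem_kdeg {q : ℤ} {v : Finset (Fin r) → B} (hv : v ∈ kdeg B r q) :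
    koszulProj B r q v = v := by
  funext t
  rw [koszulProj_apply]
  split_ifs with h
  · rfl
  · exact (hv t h).symm

theorem koszulD_koszulProj (z : Fin r → B) (q : ℤ) (v : Finset (Fin r) → B) :
    koszulD z (koszulProj B r (q + 1) v) = koszulProj B r q (koszulD z v) := by
  funext t
  rw [koszulProj_apply]
  change ∑ i ∈ tᶜ, _ = if _ then ∑ i ∈ tᶜ, _ else _
  have h : ∀ i ∈ tᶜ, koszulProj B r (q + 1) v (insert i t) =
      if (t.card : ℤ) = q then v (insert i t) else 0 := by
    intro i hi
    rw [koszulProj_apply, Finset.card_insert_of_notMem (Finset.mem_compl.1 hi), Nat.cast_add,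
      Nat.cast_one]
    simp
  rw [Finset.sum_congr rfl fun i hi => by rw [h i hi]]
  split_ifs <;> simp

theorem koszulEnd_comp (θ : B →+ N) {z : Fin r → B} {z' : Fin r → E}
    (hz : ∀ j v, θ (z j * v) = z' j • θ v) (v : Finset (Fin r) → B) (t : Finset (Fin r)) :
    koszulEnd z' N (fun s => θ (v s)) t = θ (koszulD z v t) := by
  rw [koszulEnd_apply]
  change _ = θ (∑ i ∈ tᶜ, ksign i t * z i * v (insert i t))
  rw [map_sum]
  refine Finset.sum_congr rfl fun i _ => ?_
  rw [mul_assoc, mul_smul, ← hz, ksign, ksign]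
  rcases neg_one_pow_eq_or ℤ (t.filter fun j => j < i).card with h | h
  · have h₁ := congrArg (Int.cast : ℤ → E) h
    have h₂ := congrArg (Int.cast : ℤ → B) h
    push_cast at h₁ h₂
    rw [h₁, h₂, one_smul, one_mul]
  · have h₁ := congrArg (Int.cast : ℤ → E) h
    have h₂ := congrArg (Int.cast : ℤ → B) h
    push_cast at h₁ h₂
    rw [h₁, h₂, neg_one_smul, neg_one_mul, map_neg]

theorem ProjectiveKoszul.projectiveOver_KH {z : Fin r → B} {z' : Fin r → E} {φ : k →+* B}
    {φ' : k →+* E} (h : ProjectiveKoszul φ' z' N) (θ : B ≃+ N)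
    (hz : ∀ j v, θ (z j * v) = z' j • θ v) (hφ : ∀ c v, θ (φ c * v) = φ' c • θ v) (q : ℤ) :
    ProjectiveOver φ (KH z q) := by
  have hθ := koszulEnd_comp θ.toAddMonoidHom hz
  have hθ' : ∀ w, koszulD z (fun s => θ.symm (w s)) = fun t => θ.symm (koszulEnd z' N w t) := by
    intro w
    funext t
    rw [AddEquiv.eq_symm_apply]
    refine (hθ _ t).symm.trans ?_
    simp
  let F : kcycles z q →+ LinearMap.ker (koszulEnd z' N) :=
    { toFun := fun v => ⟨fun t => θ (v.1 t), by
        funext t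
        refine (hθ v.1 t).trans ?_
        rw [LinearMap.mem_ker.1 v.2.2]
        simp⟩
      map_zero' := by ext; simp
      map_add' := fun v w => by ext; simp }
  let G : LinearMap.ker (koszulEnd z' N) →+ kcycles z q :=
    { toFun := fun w => ⟨koszulProj B r q fun t => θ.symm (w.1 t), koszulProj_mem_kdeg _ _, by
        have := koszulD_koszulProj z (q - 1) fun t => θ.symm (w.1 t)
        rw [sub_add_cancel] at this
        rw [SetLike.mem_coe, LinearMap.mem_ker, this, hθ', LinearMap.mem_ker.1 w.2]
        ext t
        simp [koszulProj_apply]⟩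
      map_zero' := by ext; simp [koszulProj_apply]
      map_add' := fun v w => by
        ext t
        simp only [koszulProj_apply, Submodule.coe_add, Pi.add_apply, map_add]
        split_ifs <;> simp }
  have hF : ∀ v ∈ (kbdries z q).comap (kcycles z q).subtype,
      F v ∈ (LinearMap.range (koszulEnd z' N)).submoduleOf (LinearMap.ker (koszulEnd z' N)) := by
    rintro v ⟨u, -, hu⟩
    refine ⟨fun t => θ (u t), funext fun t => (hθ u t).trans ?_⟩
    rw [hu]
    rfl
  have hG : ∀ w ∈ (LinearMap.range (koszulEnd z' N)).submoduleOf (LinearMap.ker (koszulEnd z' N)),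
      G w ∈ (kbdries z q).comap (kcycles z q).subtype := by
    rintro w ⟨u, hu⟩
    refine ⟨koszulProj B r (q + 1) fun t => θ.symm (u t), koszulProj_mem_kdeg _ _, ?_⟩
    rw [koszulD_koszulProj, hθ', hu]
    rfl
  refine h.of_addMonoidHom (Submodule.quotientAddMap _ _ F hF) (Submodule.quotientAddMap _ _ G hG)
    (fun c v => ?_) (fun c v => ?_) fun v => ?_
  · obtain ⟨v, rfl⟩ := Submodule.Quotient.mk_surjective _ v
    refine congrArg Submodule.Quotient.mk (Subtype.ext (funext fun t => ?_))
    exact hφ c _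
  · obtain ⟨v, rfl⟩ := Submodule.Quotient.mk_surjective _ v
    refine congrArg Submodule.Quotient.mk (Subtype.ext (funext fun t => ?_))
    change (if _ then θ.symm (φ' c • v.1 t) else 0) = φ c * (if _ then θ.symm (v.1 t) else 0)
    split_ifs
    · rw [AddEquiv.symm_apply_eq, hφ, AddEquiv.apply_symm_apply]
    · rw [mul_zero]
  · obtain ⟨v, rfl⟩ := Submodule.Quotient.mk_surjective _ v
    refine congrArg Submodule.Quotient.mk (Subtype.ext ?_)
    change koszulProj B r q (fun t => θ.symm (θ (v.1 t))) = v.1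
    simp only [AddEquiv.symm_apply_apply]
    exact koszulProj_of_mem_kdeg v.2.1

end KoszulDegree

theorem projectiveOver_ψBS_KH (m l : ℕ) (i : Fin l → Fin (m + 1)) (q : ℤ) :
    ProjectiveOver (ψBS m l i) (KH (fun j : Fin (m + 2) => xB m l i j - yB m l i j) q) := by
  obtain ⟨θ, hC, hX⟩ := exists_addEquiv_crossings l i
  refine (projectiveKoszul_crossings (xSeq m) (m + 2) _ fun a ha => ?_).projectiveOver_KH θ
    (fun j v => ?_) hC q
  · obtain ⟨t, rfl⟩ := List.mem_ofFn.1 ha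
    omega
  · rw [sub_mul, map_sub, hX, ← ψBS_X, hC, koszulSeq, xSeq_fin, sub_smul]

section GradedKoszul

open Polynomial (coeff monomial)

/-- An `ℕ`-grading of a ring, encoded by the coaction `a ↦ ∑ n, a_n T^n`. -/
structure GradingCoaction (B : Type) [CommRing B] where
  /-- The map sending `a` to `∑ n, a_n T^n`. -/
  hom : B →+* Polynomial B
  eval_one : ∀ a, (hom a).eval 1 = a
  hom_coeff : ∀ n a, hom ((hom a).coeff n) = monomial n ((hom a).coeff n)

namespace GradingCoaction

variable {B : Type} [CommRing B] {r : ℕ} (γ : GradingCoaction B)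

/-- The projection to the component of degree `n`. -/
def proj (n : ℕ) : B →+ B := (Polynomial.lcoeff B n).toAddMonoidHom.comp γ.hom.toAddMonoidHom

theorem proj_apply (n : ℕ) (a : B) : γ.proj n a = (γ.hom a).coeff n := rfl

theorem proj_proj_self (n : ℕ) (a : B) : γ.proj n (γ.proj n a) = γ.proj n a := by
  rw [proj_apply, proj_apply, γ.hom_coeff, Polynomial.coeff_monomial_same]

theorem proj_proj_of_ne {n n' : ℕ} (h : n ≠ n') (a : B) : γ.proj n (γ.proj n' a) = 0 := by
  rw [proj_apply, proj_apply, γ.hom_coeff, Polynomial.coeff_monomial_of_ne _ h]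

theorem sum_proj (a : B) {N : ℕ} (h : (γ.hom a).natDegree < N) :
    ∑ n ∈ Finset.range N, γ.proj n a = a := by
  conv_rhs => rw [← γ.eval_one a, Polynomial.eval_eq_sum_range' h]
  simp [proj_apply]

theorem proj_zero_mul {z : B} (hz : γ.hom z = Polynomial.C z * Polynomial.X) (a : B) :
    γ.proj 0 (z * a) = 0 := by
  rw [proj_apply, map_mul, hz, mul_right_comm, Polynomial.coeff_mul_X_zero]

theorem proj_succ_mul {z : B} (hz : γ.hom z = Polynomial.C z * Polynomial.X) (n : ℕ) (a : B) :
    γ.proj (n + 1) (z * a) = z * γ.proj n a := by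
  rw [proj_apply, map_mul, hz, mul_right_comm, Polynomial.coeff_mul_X, Polynomial.coeff_C_mul,
    proj_apply]

theorem proj_ksign_mul (n : ℕ) (j : Fin r) (t : Finset (Fin r)) (a : B) :
    γ.proj n (ksign j t * a) = ksign j t * γ.proj n a := by
  rw [ksign]
  rcases neg_one_pow_eq_or B (t.filter fun i => i < j).card with h | h <;> simp [h]

variable {z : Fin r → B}

theorem proj_zero_koszulD
    (hz : ∀ j, γ.hom (z j) = Polynomial.C (z j) * Polynomial.X)
    (v : KModule B r) (t : Finset (Fin r)) :
    γ.proj 0 (koszulD z v t) = 0 := by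
  change γ.proj 0 (∑ i ∈ tᶜ, ksign i t * z i * v (insert i t)) = 0
  rw [map_sum]
  refine Finset.sum_eq_zero fun i _ => ?_
  rw [mul_assoc, proj_ksign_mul, γ.proj_zero_mul (hz i), mul_zero]

theorem proj_succ_koszulD
    (hz : ∀ j, γ.hom (z j) = Polynomial.C (z j) * Polynomial.X)
    (n : ℕ) (v : KModule B r) (t : Finset (Fin r)) :
    γ.proj (n + 1) (koszulD z v t) = koszulD z (fun s => γ.proj n (v s)) t := by
  change γ.proj (n + 1) (∑ i ∈ tᶜ, ksign i t * z i * v (insert i t)) =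
    ∑ i ∈ tᶜ, ksign i t * z i * γ.proj n (v (insert i t))
  rw [map_sum]
  refine Finset.sum_congr rfl fun i _ => ?_
  rw [mul_assoc, proj_ksign_mul, γ.proj_succ_mul (hz i), mul_assoc]

/-- The projection of Koszul cycles to internal degree `n`. -/
def projCycles (hz : ∀ j, γ.hom (z j) = Polynomial.C (z j) * Polynomial.X) (n : ℕ) (q : ℤ) : kcycles z q →+ kcycles z q where
  toFun v := ⟨fun t => γ.proj n (v.1 t), fun t ht =>
    (congrArg (γ.proj n) (v.2.1 t ht)).trans (map_zero _), by
    funext t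
    rw [← γ.proj_succ_koszulD hz, LinearMap.mem_ker.1 v.2.2]
    exact map_zero _⟩
  map_zero' := by ext; simp
  map_add' v w := by ext; simp

/-- The projection of Koszul homology to internal degree `n`. -/
def projKH (hz : ∀ j, γ.hom (z j) = Polynomial.C (z j) * Polynomial.X) (n : ℕ) (q : ℤ) : KH z q →+ KH z q :=
  Submodule.quotientAddMap _ _ (γ.projCycles hz n q) (by
    rintro v ⟨u, hu, huv⟩
    rw [Submodule.mem_comap]
    have huv' : ∀ t, v.1 t = koszulD z u t := fun t => congrFun huv.symm t
    cases n with
    | zero =>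
      have : (kcycles z q).subtype (γ.projCycles hz 0 q v) = 0 := by
        funext t
        change γ.proj 0 (v.1 t) = 0
        rw [huv', γ.proj_zero_koszulD hz]
      rw [this]
      exact zero_mem _
    | succ n =>
      refine ⟨fun t => γ.proj n (u t), fun t ht =>
        (congrArg (γ.proj n) (hu t ht)).trans (map_zero _), ?_⟩
      funext t
      change _ = γ.proj (n + 1) (v.1 t)
      rw [huv', γ.proj_succ_koszulD hz])

theorem projKH_mk (hz : ∀ j, γ.hom (z j) = Polynomial.C (z j) * Polynomial.X)
    (n : ℕ) (q : ℤ) (v : kcycles z q) :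
    γ.projKH hz n q (Submodule.Quotient.mk v) = Submodule.Quotient.mk (γ.projCycles hz n q v) :=
  rfl

/-- Koszul homology of a graded ring that is finite and projective over a polynomial ring with
variables in degree one is free. -/
theorem free_KH (hz : ∀ j, γ.hom (z j) = Polynomial.C (z j) * Polynomial.X)
    {s : ℕ} [IsNoetherianRing B] (ψ : MvPolynomial (Fin s) ℤ →+* B)
    (hψ : ψ.Finite) (hX : ∀ j, γ.hom (ψ (X j)) = Polynomial.C (ψ (X j)) * Polynomial.X) (q : ℤ)
    (hproj : ProjectiveOver ψ (KH z q)) :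
    @Module.Free (MvPolynomial (Fin s) ℤ) (KH z q) _ _ (Module.compHom _ ψ) := by
  let _ : Algebra (MvPolynomial (Fin s) ℤ) B := ψ.toAlgebra
  let _ : Module (MvPolynomial (Fin s) ℤ) (KH z q) := Module.compHom _ ψ
  have : IsScalarTower (MvPolynomial (Fin s) ℤ) B (KH z q) :=
    .of_algebraMap_smul fun _ _ => rfl
  have : Module.Finite (MvPolynomial (Fin s) ℤ) B := hψ
  have : Module.Finite (MvPolynomial (Fin s) ℤ) (KH z q) := Module.Finite.trans B _
  have : Module.Projective (MvPolynomial (Fin s) ℤ) (KH z q) := hproj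
  refine Module.free_of_graded (fun n => γ.projKH hz n q) (fun j v => ?_) (fun n j v => ?_)
    (fun n v => ?_) (fun a b v hab => ?_) fun v => ?_
  · obtain ⟨v, rfl⟩ := Submodule.Quotient.mk_surjective _ v
    have : γ.projCycles hz 0 q (ψ (X j) • v) = 0 :=
      Subtype.ext (funext fun t => γ.proj_zero_mul (hX j) (v.1 t))
    change (Submodule.Quotient.mk (γ.projCycles hz 0 q (ψ (X j) • v)) : KH z q) = 0
    rw [this, Submodule.Quotient.mk_zero]
  · obtain ⟨v, rfl⟩ := Submodule.Quotient.mk_surjective _ v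
    exact congrArg Submodule.Quotient.mk
      (Subtype.ext (funext fun t => γ.proj_succ_mul (hX j) n (v.1 t)))
  · obtain ⟨v, rfl⟩ := Submodule.Quotient.mk_surjective _ v
    exact congrArg Submodule.Quotient.mk
      (Subtype.ext (funext fun t => γ.proj_proj_self n (v.1 t)))
  · obtain ⟨v, rfl⟩ := Submodule.Quotient.mk_surjective _ v
    have : γ.projCycles hz a q (γ.projCycles hz b q v) = 0 :=
      Subtype.ext (funext fun t => γ.proj_proj_of_ne hab (v.1 t))
    rw [projKH_mk, projKH_mk, this, Submodule.Quotient.mk_zero]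
  · obtain ⟨v, rfl⟩ := Submodule.Quotient.mk_surjective _ v
    refine ⟨Finset.univ.sup (fun t => (γ.hom (v.1 t)).natDegree) + 1, fun N hN => ?_⟩
    have h : ∑ n ∈ Finset.range N, γ.projCycles hz n q v = v := by
      ext t
      rw [AddSubmonoidClass.coe_finsetSum, Finset.sum_apply]
      refine γ.sum_proj (v.1 t) (lt_of_lt_of_le (Nat.lt_succ_of_le ?_) hN)
      exact Finset.le_sup (f := fun t => (γ.hom (v.1 t)).natDegree) (Finset.mem_univ t)
    conv_rhs => rw [← h]
    exact (map_sum (Submodule.mkQ _) _ _).symm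

end GradingCoaction

end GradedKoszul

section BottSamelsonGrading

variable {m l : ℕ}

/-- The coaction of the grading of the Bott–Samelson ring on polynomials. -/
def polyCoaction (m l : ℕ) (i : Fin l → Fin (m + 1)) : BSPoly m l →+* Polynomial (BSRing m l i) :=
  (aeval fun v => Polynomial.C (Ideal.Quotient.mk _ (X v) : BSRing m l i) *
    Polynomial.X).toRingHom

theorem polyCoaction_X (i : Fin l → Fin (m + 1)) (v : Fin (m + 2) ⊕ Fin l) :
    polyCoaction m l i (X v) =
      Polynomial.C (Ideal.Quotient.mk _ (X v) : BSRing m l i) * Polynomial.X := by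
  simp [polyCoaction]

theorem polyCoaction_BSrel (i : Fin l → Fin (m + 1)) (t : Fin l) :
    polyCoaction m l i (BSrel m l i t) = 0 := by
  have h : polyCoaction m l i (BSrel m l i t) =
      Polynomial.C (Ideal.Quotient.mk _ (BSrel m l i t) : BSRing m l i) * Polynomial.X ^ 2 := by
    simp only [BSrel, map_mul, map_add, map_sub, map_sum, map_ofNat, polyCoaction_X,
      ← Finset.sum_mul]
    ring
  rw [h, Ideal.Quotient.eq_zero_iff_mem.2 (Ideal.subset_span (Set.mem_range_self t)), map_zero,
    zero_mul]

/-- The coaction of the grading of the Bott–Samelson ring. -/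
def bsCoaction (m l : ℕ) (i : Fin l → Fin (m + 1)) :
    BSRing m l i →+* Polynomial (BSRing m l i) :=
  Ideal.Quotient.lift _ (polyCoaction m l i) (by
    suffices h : Ideal.span (Set.range (BSrel m l i)) ≤ RingHom.ker (polyCoaction m l i) from
      fun a ha => h ha
    rw [Ideal.span_le]
    rintro _ ⟨t, rfl⟩
    exact polyCoaction_BSrel i t)

theorem bsCoaction_mk_X (i : Fin l → Fin (m + 1)) (v : Fin (m + 2) ⊕ Fin l) :
    bsCoaction m l i (Ideal.Quotient.mk _ (X v)) =
      Polynomial.C (Ideal.Quotient.mk _ (X v) : BSRing m l i) * Polynomial.X :=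
  polyCoaction_X i v

/-- The grading of the Bott–Samelson ring with all generators in degree one. -/
def bsGrading (m l : ℕ) (i : Fin l → Fin (m + 1)) : GradingCoaction (BSRing m l i) where
  hom := bsCoaction m l i
  eval_one a := by
    refine RingHom.congr_fun
      (f := (Polynomial.evalRingHom 1).comp (bsCoaction m l i)) (g := RingHom.id _)
      (Ideal.Quotient.ringHom_ext (MvPolynomial.ringHom_ext (fun n => by simp) fun v => ?_)) a
    simp only [RingHom.comp_apply, bsCoaction_mk_X]
    simp
  hom_coeff n a := by
    obtain ⟨p, rfl⟩ := Ideal.Quotient.mk_surjective a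
    induction p using MvPolynomial.induction_on generalizing n with
    | C c =>
      have hc : (Ideal.Quotient.mk _ (C c) : BSRing m l i) = (c : BSRing m l i) := by simp
      rw [hc, map_intCast, ← map_intCast (Polynomial.C : BSRing m l i →+* _), Polynomial.coeff_C]
      split_ifs with h
      · rw [h, map_intCast, Polynomial.monomial_zero_left, map_intCast]
      · rw [map_zero, map_zero]
    | add p q hp hq =>
      rw [map_add, map_add, Polynomial.coeff_add, map_add, hp, hq, map_add]
    | mul_X p v hp =>
      rw [map_mul, map_mul, bsCoaction_mk_X, ← mul_assoc]
      cases n with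
      | zero => rw [Polynomial.coeff_mul_X_zero, map_zero, map_zero]
      | succ n =>
        rw [Polynomial.coeff_mul_X, Polynomial.coeff_mul_C, map_mul, hp, bsCoaction_mk_X,
          ← mul_assoc, Polynomial.monomial_mul_C, Polynomial.monomial_mul_X]

theorem bsGrading_hom_xB (i : Fin l → Fin (m + 1)) (j : Fin (m + 2)) :
    (bsGrading m l i).hom (xB m l i j) = Polynomial.C (xB m l i j) * Polynomial.X :=
  bsCoaction_mk_X i _

theorem bsGrading_hom_yB (i : Fin l → Fin (m + 1)) (j : Fin (m + 2)) :
    (bsGrading m l i).hom (yB m l i j) = Polynomial.C (yB m l i j) * Polynomial.X := by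
  have h : ∀ c, (bsGrading m l i).hom (δhat m l i c) =
      Polynomial.C (δhat m l i c) * Polynomial.X := by
    intro c
    rw [δhat, map_sum, map_sum Polynomial.C, Finset.sum_mul]
    exact Finset.sum_congr rfl fun t _ => bsCoaction_mk_X i _
  rw [yB, map_sub, map_add, h, h, bsGrading_hom_xB, map_sub, map_add]
  ring

end BottSamelsonGrading

/-- Let `r = m + 2 ≥ 2` and let `J = (i_1,…,i_l)` be a sequence of
crossing indices.  Every Koszul homology module `H_q` of the Koszul complex
`K(R_J; x_1 − y_1, …, x_r − y_r)` (computing the Hochschild homology of the Soergel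
bimodule attached to `J`) is a free module over `ℤ[x_1,…,x_r]`, the module structure
being restriction of scalars along `ℤ[x_1,…,x_r] → R_J`, `x_j ↦ x_j`. -/
theorem stmt9 (m l : ℕ) (i : Fin l → Fin (m + 1)) (q : ℤ) :
    @Module.Free (MvPolynomial (Fin (m + 2)) ℤ)
      (KH (fun j : Fin (m + 2) => xB m l i j - yB m l i j) q) _ _
      (Module.compHom _ (ψBS m l i)) := by
  refine (bsGrading m l i).free_KH (fun j => ?_) (ψBS m l i) (ψBS_finite l i) (fun j => ?_) q
    (projectiveOver_ψBS_KH m l i q)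
  · rw [map_sub, bsGrading_hom_xB, bsGrading_hom_yB, map_sub, sub_mul]
  · rw [ψBS_X, bsGrading_hom_xB]
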